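/- A cardinal κ is shrewd if and only if for all cardinals θ > κ and all z ∈ H(θ), there exist cardinals κ̄ < θ̄ < κ, an elementary submodel X of H(θ̄), and an elementary embedding j : X → H(θ) such that κ̄ + 1 ⊆ X, j restricted to κ̄ is the identity, j(κ̄) = κ, and z is in the range of j. -/

import Mathlib

universe u

open Cardinal

/-- Formulas of the language of set theory with an additional unary predicate
symbol `pred`; variables are indexed by natural numbers. -/
inductive SF : Type
  | mem : ℕ → ℕ → SF
  | eq : ℕ → ℕ → SF
  | pred : ℕ → SF
  | not : SF → SF
  | and : SF → SF → SF
  | ex : ℕ → SF → SF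

/-- The free variables of a formula. -/
def SF.fv : SF → Set ℕ
  | .mem i j => {i, j}
  | .eq i j => {i, j}
  | .pred i => {i}
  | .not φ => φ.fv
  | .and φ ψ => φ.fv ∪ ψ.fv
  | .ex k φ => φ.fv \ {k}

/-- Tarskian satisfaction of a formula in the structure whose carrier is the
class `S`, where the membership symbol is interpreted by the binary relation `E`
and the extra unary predicate symbol by the class `P`, under the valuation `v`. -/
def Sat (P : Set ZFSet.{u}) (E : ZFSet.{u} → ZFSet.{u} → Prop) (S : Set ZFSet.{u}) :
    SF → (ℕ → ZFSet.{u}) → Prop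
  | .mem i j, v => E (v i) (v j)
  | .eq i j, v => v i = v j
  | .pred i, v => v i ∈ P
  | .not φ, v => ¬ Sat P E S φ v
  | .and φ ψ, v => Sat P E S φ v ∧ Sat P E S ψ v
  | .ex k φ, v => ∃ x, x ∈ S ∧ Sat P E S φ (Function.update v k x)

/-- Satisfaction in the `∈`-structure with carrier `S`, the predicate symbol
being interpreted by the class `R`. -/
def SatIn (R : Set ZFSet.{u}) (S : Set ZFSet.{u}) (φ : SF) (v : ℕ → ZFSet.{u}) : Prop :=
  Sat R (· ∈ ·) S φ v

/-- Δ₀-formulas: built from atomic formulas by propositional connectives and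
bounded existential quantification. -/
inductive IsDeltaZero : SF → Prop
  | mem (i j) : IsDeltaZero (.mem i j)
  | eq (i j) : IsDeltaZero (.eq i j)
  | pred (i) : IsDeltaZero (.pred i)
  | not {φ} : IsDeltaZero φ → IsDeltaZero (.not φ)
  | and {φ ψ} : IsDeltaZero φ → IsDeltaZero ψ → IsDeltaZero (.and φ ψ)
  | bex {φ} (k j) : IsDeltaZero φ → IsDeltaZero (.ex k (.and (.mem k j) φ))

mutual
  /-- Σₙ-formulas of the Lévy hierarchy. -/
  inductive IsSigma : ℕ → SF → Prop
    | of_zero {φ} : IsDeltaZero φ → IsSigma 0 φ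
    | of_pi {n φ} : IsPi n φ → IsSigma (n + 1) φ
    | ex {n φ} (k) : IsSigma (n + 1) φ → IsSigma (n + 1) (.ex k φ)
  /-- Πₙ-formulas of the Lévy hierarchy. -/
  inductive IsPi : ℕ → SF → Prop
    | of_zero {φ} : IsDeltaZero φ → IsPi 0 φ
    | not {n φ} : IsSigma (n + 1) φ → IsPi (n + 1) (.not φ)
end

/-- The valuation sending `v₀` to `a`, `v₁` to `b` and all other variables to `∅`. -/
def val2 (a b : ZFSet.{u}) : ℕ → ZFSet.{u} := fun i => if i = 0 then a else if i = 1 then b else ∅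

/-- `x` is a (von Neumann) ordinal. -/
def ZOrd (x : ZFSet.{u}) : Prop := x.IsTransitive ∧ ∀ y ∈ x, ZFSet.IsTransitive y

/-- `κ` is a (von Neumann) cardinal. -/
def ZCard (κ : ZFSet.{u}) : Prop := ZOrd κ ∧ ∀ β ∈ κ, #β.toSet < #κ.toSet

/-- `κ` is an infinite cardinal. -/
def InfCard (κ : ZFSet.{u}) : Prop := ZCard κ ∧ ZFSet.omega ⊆ κ

/-- `κ` is an infinite regular cardinal: every cofinal subset of `κ` has
cardinality `κ`. -/
def ZRegular (κ : ZFSet.{u}) : Prop :=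
  InfCard κ ∧ ∀ x : ZFSet.{u}, x ⊆ κ →
    (∀ β ∈ κ, ∃ γ ∈ x, β ∈ γ ∨ β = γ) → #x.toSet = #κ.toSet

/-- `C` is a closed unbounded (class of) subset(s) of the ordinal `κ`. -/
def ZClub (C : Set ZFSet.{u}) (κ : ZFSet.{u}) : Prop :=
  (∀ γ ∈ C, γ ∈ κ) ∧ (∀ β ∈ κ, ∃ γ ∈ C, β ∈ γ) ∧
    (∀ β ∈ κ, (∃ γ, γ ∈ β) → (∀ γ ∈ β, ∃ δ ∈ C, γ ∈ δ ∧ δ ∈ β) → β ∈ C)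

/-- `S` is stationary in `κ`: it meets every closed unbounded subset of `κ`. -/
def ZStationary (S : Set ZFSet.{u}) (κ : ZFSet.{u}) : Prop :=
  ∀ C, ZClub C κ → ∃ γ ∈ C, γ ∈ S

/-- `H(θ)`: the class of all sets hereditarily of cardinality less than `θ`. -/
def HSet (θ : ZFSet.{u}) : Set ZFSet.{u} :=
  {x | ∃ t : ZFSet.{u}, t.IsTransitive ∧ x ⊆ t ∧ #t.toSet < #θ.toSet}

/-- `θ` is the cardinal successor `κ⁺` of `κ`. -/
def SuccCardOf (θ κ : ZFSet.{u}) : Prop :=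
  ZCard θ ∧ κ ∈ θ ∧ ∀ μ, ZCard μ → κ ∈ μ → θ ⊆ μ

/-- `κ` is a weakly shrewd cardinal. -/
def WeaklyShrewd (κ : ZFSet.{u}) : Prop :=
  InfCard κ ∧
    ∀ (φ : SF) (θ A : ZFSet.{u}), φ.fv ⊆ {0, 1} → ZCard θ → κ ∈ θ → A ⊆ κ →
      SatIn ∅ (HSet θ) φ (val2 A κ) →
      ∃ κ' θ' : ZFSet.{u}, ZCard κ' ∧ ZCard θ' ∧ κ' ∈ θ' ∧ κ' ∈ κ ∧
        SatIn ∅ (HSet θ') φ (val2 (A ∩ κ') κ')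

/-- `j` is an elementary embedding of the `∈`-structure (with predicate `R`)
with carrier `X` into the one with carrier `Y`. -/
def ElemEmbOn (R : Set ZFSet.{u}) (X Y : Set ZFSet.{u}) (j : ZFSet.{u} → ZFSet.{u}) : Prop :=
  (∀ x ∈ X, j x ∈ Y) ∧
    ∀ (φ : SF) (v : ℕ → ZFSet.{u}), (∀ i, v i ∈ X) →
      (SatIn R X φ v ↔ SatIn R Y φ (fun i => j (v i)))

/-- `X` is an elementary submodel of `Y` (as `∈`-structures with predicate `R`). -/
def ElemSub (R : Set ZFSet.{u}) (X Y : Set ZFSet.{u}) : Prop :=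
  X ⊆ Y ∧ ∀ (φ : SF) (v : ℕ → ZFSet.{u}), (∀ i, v i ∈ X) → (SatIn R X φ v ↔ SatIn R Y φ v)

/-- `X` is a Σₙ-elementary submodel of `Y`. -/
def SigmaElemSub (R : Set ZFSet.{u}) (n : ℕ) (X Y : Set ZFSet.{u}) : Prop :=
  X ⊆ Y ∧ ∀ (φ : SF), IsSigma n φ → ∀ (v : ℕ → ZFSet.{u}), (∀ i, v i ∈ X) →
    (SatIn R X φ v ↔ SatIn R Y φ v)

/-- The stages of the von Neumann hierarchy, as classes:
`Vclass o` consists of all sets of rank less than `o`. -/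
def Vclass (o : Ordinal.{u}) : Set ZFSet.{u} := {x | ZFSet.rank x < o}

/-- The intersection `A ∩ V_c` (for `c` an ordinal). -/
def Vres (A c : ZFSet.{u}) : ZFSet.{u} :=
  ZFSet.sep (fun y => ZFSet.rank y < ZFSet.rank c) A

/-- `κ` is a shrewd cardinal (Rathjen): for every formula `Φ(v₀,v₁)`, every
ordinal `α` and every `A ⊆ V_κ` such that `Φ(A,κ)` holds in `V_{κ+α}`, there
are ordinals `κ̄, ᾱ < κ` such that `Φ(A ∩ V_κ̄, κ̄)` holds in `V_{κ̄+ᾱ}`. -/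
def Shrewd (κ : ZFSet.{u}) : Prop :=
  ZCard κ ∧
    ∀ (φ : SF) (α A : ZFSet.{u}), φ.fv ⊆ {0, 1} → ZOrd α →
      (∀ y ∈ A, ZFSet.rank y < ZFSet.rank κ) →
      SatIn ∅ (Vclass (ZFSet.rank κ + ZFSet.rank α)) φ (val2 A κ) →
      ∃ κ' α' : ZFSet.{u}, κ' ∈ κ ∧ α' ∈ κ ∧
        SatIn ∅ (Vclass (ZFSet.rank κ' + ZFSet.rank α')) φ (val2 (Vres A κ') κ')





def Df (P : Set ZFSet.{u} → (ℕ → ZFSet.{u}) → Prop) : Prop :=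
  ∃ n : ℕ, (∀ S e e', (∀ i < n, e i = e' i) → (P S e ↔ P S e')) ∧
    ∀ idx : ℕ → ℕ, ∃ φ : SF, φ.fv ⊆ idx '' Set.Iio n ∧
      ∀ S v, SatIn ∅ S φ v ↔ P S (fun i => v (idx i))

theorem Df.mem (i j : ℕ) : Df.{u} (fun _ e => e i ∈ e j) := by
  refine ⟨max i j + 1, ?_, fun idx => ⟨.mem (idx i) (idx j), ?_, ?_⟩⟩
  · intro S e e' h
    simp only [h i (by omega), h j (by omega)]
  · intro k hk
    simp only [SF.fv, Set.mem_insert_iff, Set.mem_singleton_iff] at hk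
    rcases hk with rfl | rfl
    · exact ⟨i, by simp only [Set.mem_Iio]; omega, rfl⟩
    · exact ⟨j, by simp only [Set.mem_Iio]; omega, rfl⟩
  · intro S v
    rfl

theorem Df.eq (i j : ℕ) : Df.{u} (fun _ e => e i = e j) := by
  refine ⟨max i j + 1, ?_, fun idx => ⟨.eq (idx i) (idx j), ?_, ?_⟩⟩
  · intro S e e' h
    simp only [h i (by omega), h j (by omega)]
  · intro k hk
    simp only [SF.fv, Set.mem_insert_iff, Set.mem_singleton_iff] at hk
    rcases hk with rfl | rfl
    · exact ⟨i, by simp only [Set.mem_Iio]; omega, rfl⟩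
    · exact ⟨j, by simp only [Set.mem_Iio]; omega, rfl⟩
  · intro S v
    rfl

theorem Df.not {P : Set ZFSet.{u} → (ℕ → ZFSet.{u}) → Prop} (h : Df P) :
    Df (fun S e => ¬ P S e) := by
  obtain ⟨n, h1, h2⟩ := h
  refine ⟨n, fun S e e' h => not_congr (h1 S e e' h), fun idx => ?_⟩
  obtain ⟨φ, h3, h4⟩ := h2 idx
  exact ⟨.not φ, h3, fun S v => not_congr (h4 S v)⟩

theorem Df.and {P Q : Set ZFSet.{u} → (ℕ → ZFSet.{u}) → Prop} (h : Df P) (h' : Df Q) :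
    Df (fun S e => P S e ∧ Q S e) := by
  obtain ⟨n, h1, h2⟩ := h
  obtain ⟨n', h1', h2'⟩ := h'
  refine ⟨max n n', fun S e e' h => and_congr (h1 S e e' fun i hi => h i (by omega))
    (h1' S e e' fun i hi => h i (by omega)), fun idx => ?_⟩
  obtain ⟨φ, h3, h4⟩ := h2 idx
  obtain ⟨ψ, h3', h4'⟩ := h2' idx
  refine ⟨.and φ ψ, ?_, fun S v => and_congr (h4 S v) (h4' S v)⟩
  refine Set.union_subset (h3.trans (Set.image_mono ?_)) (h3'.trans (Set.image_mono ?_))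
  · exact Set.Iio_subset_Iio (by omega)
  · exact Set.Iio_subset_Iio (by omega)

theorem Df.congr {P Q : Set ZFSet.{u} → (ℕ → ZFSet.{u}) → Prop} (h : Df P)
    (h' : ∀ S e, P S e ↔ Q S e) : Df Q := by
  have : P = Q := by
    funext S e
    exact propext (h' S e)
  rwa [← this]

theorem Df.or {P Q : Set ZFSet.{u} → (ℕ → ZFSet.{u}) → Prop} (h : Df P) (h' : Df Q) :
    Df (fun S e => P S e ∨ Q S e) :=
  (h.not.and h'.not).not.congr fun S e => by tauto

theorem Df.imp {P Q : Set ZFSet.{u} → (ℕ → ZFSet.{u}) → Prop} (h : Df P) (h' : Df Q) :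
    Df (fun S e => P S e → Q S e) :=
  (h.and h'.not).not.congr fun S e => by tauto

theorem Df.iff {P Q : Set ZFSet.{u} → (ℕ → ZFSet.{u}) → Prop} (h : Df P) (h' : Df Q) :
    Df (fun S e => P S e ↔ Q S e) :=
  ((h.imp h').and (h'.imp h)).congr fun S e => by tauto

theorem Df.ex {P : Set ZFSet.{u} → (ℕ → ZFSet.{u}) → ZFSet.{u} → Prop}
    (h : Df (fun S e => P S (fun i => e (i + 1)) (e 0))) :
    Df (fun S e => ∃ x ∈ S, P S e x) := by
  obtain ⟨n, h1, h2⟩ := h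
  have key : ∀ S e e' x, (∀ i < n, e i = e' i) → (P S e x ↔ P S e' x) := by
    intro S e e' x h
    have := h1 S (fun i => Nat.casesOn i x e) (fun i => Nat.casesOn i x e') ?_
    · exact this
    · intro i hi
      cases i with
      | zero => rfl
      | succ i => exact h i (by omega)
  refine ⟨n, fun S e e' h => exists_congr fun x => and_congr Iff.rfl (key S e e' x h),
    fun idx => ?_⟩
  obtain ⟨k, hk⟩ : ∃ k, ∀ i < n, idx i < k := by
    refine ⟨(Finset.range n).sup idx + 1, fun i hi => ?_⟩
    have := Finset.le_sup (f := idx) (Finset.mem_range.2 hi)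
    omega
  obtain ⟨φ, h3, h4⟩ := h2 (fun i => Nat.casesOn i k idx)
  refine ⟨.ex k φ, ?_, ?_⟩
  · rintro m ⟨hm, hmk⟩
    obtain ⟨i, hi, rfl⟩ := h3 hm
    cases i with
    | zero => exact absurd rfl hmk
    | succ i => exact ⟨i, by simp only [Set.mem_Iio] at hi ⊢; omega, rfl⟩
  · intro S v
    refine exists_congr fun x => and_congr Iff.rfl ?_
    refine (h4 S (Function.update v k x)).trans ?_
    have hx : Function.update v k x (Nat.rec k (fun n _ => idx n) 0 : ℕ) = x :=
      Function.update_self ..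
    simp only [hx]
    refine key _ _ _ _ fun i hi => ?_
    exact Function.update_of_ne (hk i hi).ne _ _

theorem Df.all {P : Set ZFSet.{u} → (ℕ → ZFSet.{u}) → ZFSet.{u} → Prop}
    (h : Df (fun S e => P S (fun i => e (i + 1)) (e 0))) :
    Df (fun S e => ∀ x ∈ S, P S e x) :=
  (Df.ex (P := fun S e x => ¬ P S e x) h.not).not.congr fun S e => by
    push Not
    rfl

theorem Df.true : Df.{u} (fun _ _ => True) :=
  ((Df.mem 0 0).imp (Df.mem 0 0)).congr fun S e => by tauto

theorem Df.formula2 {P : Set ZFSet.{u} → ZFSet.{u} → ZFSet.{u} → Prop}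
    (h : Df (fun S e => P S (e 0) (e 1))) :
    ∃ φ : SF, φ.fv ⊆ {0, 1} ∧ ∀ S a b, SatIn ∅ S φ (val2 a b) ↔ P S a b := by
  obtain ⟨n, -, h2⟩ := h
  obtain ⟨φ, h3, h4⟩ := h2 (fun i => min i 1)
  refine ⟨φ, fun m hm => ?_, fun S a b => ?_⟩
  · obtain ⟨i, -, rfl⟩ := h3 hm
    simp only [Set.mem_insert_iff, Set.mem_singleton_iff]
    omega
  · rw [h4]
    simp [val2]

theorem Df.transfer {P : Set ZFSet.{u} → (ℕ → ZFSet.{u}) → Prop} (h : Df P)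
    {S S' : Set ZFSet.{u}} {e e' : ℕ → ZFSet.{u}}
    (hs : ∀ φ : SF, SatIn ∅ S φ e ↔ SatIn ∅ S' φ e') : P S e ↔ P S' e' := by
  obtain ⟨n, -, h2⟩ := h
  obtain ⟨φ, -, h4⟩ := h2 id
  exact ((h4 S e).symm.trans (hs φ)).trans (h4 S' e')


def rSub (S : Set ZFSet.{u}) (x y : ZFSet.{u}) : Prop := ∀ u ∈ S, u ∈ x → u ∈ y

def rTrans (S : Set ZFSet.{u}) (x : ZFSet.{u}) : Prop := ∀ u ∈ S, u ∈ x → rSub S u x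

def rOrd (S : Set ZFSet.{u}) (x : ZFSet.{u}) : Prop :=
  rTrans S x ∧ ∀ u ∈ S, u ∈ x → rTrans S u

def rUp (S : Set ZFSet.{u}) (w x y : ZFSet.{u}) : Prop :=
  x ∈ w ∧ y ∈ w ∧ ∀ u ∈ S, u ∈ w → u = x ∨ u = y

def rPair (S : Set ZFSet.{u}) (p x y : ZFSet.{u}) : Prop :=
  (∃ w ∈ S, w ∈ p ∧ rUp S w x x) ∧ (∃ w ∈ S, w ∈ p ∧ rUp S w x y) ∧
    ∀ w ∈ S, w ∈ p → rUp S w x x ∨ rUp S w x y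

def rApp (S : Set ZFSet.{u}) (f x y : ZFSet.{u}) : Prop := ∃ p ∈ S, p ∈ f ∧ rPair S p x y

def rFun (S : Set ZFSet.{u}) (f : ZFSet.{u}) : Prop :=
  ∀ x ∈ S, ∀ y ∈ S, ∀ y' ∈ S, rApp S f x y → rApp S f x y' → y = y'

def rSurj (S : Set ZFSet.{u}) (f a b : ZFSet.{u}) : Prop :=
  rFun S f ∧ ∀ y ∈ S, y ∈ b → ∃ x ∈ S, x ∈ a ∧ rApp S f x y

theorem Df.rSub (i j : ℕ) : Df.{u} (fun S e => rSub S (e i) (e j)) := by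
  unfold _root_.rSub
  repeat' first | exact Df.mem _ _ | exact Df.eq _ _ | apply Df.all | apply Df.ex | apply Df.and |
    apply Df.or | apply Df.iff | apply Df.not | apply Df.imp

theorem Df.rTrans (i : ℕ) : Df.{u} (fun S e => rTrans S (e i)) := by
  unfold _root_.rTrans
  repeat' first | exact Df.mem _ _ | exact Df.eq _ _ | exact Df.rSub _ _ | apply Df.all | apply Df.ex | apply Df.and |
    apply Df.or | apply Df.iff | apply Df.not | apply Df.imp

theorem Df.rOrd (i : ℕ) : Df.{u} (fun S e => rOrd S (e i)) := by
  unfold _root_.rOrd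
  repeat' first | exact Df.mem _ _ | exact Df.eq _ _ | exact Df.rTrans _ | apply Df.all | apply Df.ex | apply Df.and |
    apply Df.or | apply Df.iff | apply Df.not | apply Df.imp

theorem Df.rUp (i j k : ℕ) : Df.{u} (fun S e => rUp S (e i) (e j) (e k)) := by
  unfold _root_.rUp
  repeat' first | exact Df.mem _ _ | exact Df.eq _ _ | apply Df.all | apply Df.ex | apply Df.and |
    apply Df.or | apply Df.iff | apply Df.not | apply Df.imp

theorem Df.rPair (i j k : ℕ) : Df.{u} (fun S e => rPair S (e i) (e j) (e k)) := by
  unfold _root_.rPair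
  repeat' first | exact Df.mem _ _ | exact Df.eq _ _ | exact Df.rUp _ _ _ | apply Df.all | apply Df.ex | apply Df.and |
    apply Df.or | apply Df.iff | apply Df.not | apply Df.imp

theorem Df.rApp (i j k : ℕ) : Df.{u} (fun S e => rApp S (e i) (e j) (e k)) := by
  unfold _root_.rApp
  repeat' first | exact Df.mem _ _ | exact Df.eq _ _ | exact Df.rPair _ _ _ | apply Df.all | apply Df.ex | apply Df.and |
    apply Df.or | apply Df.iff | apply Df.not | apply Df.imp

theorem Df.rFun (i : ℕ) : Df.{u} (fun S e => rFun S (e i)) := by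
  unfold _root_.rFun
  repeat' first | exact Df.mem _ _ | exact Df.eq _ _ | exact Df.rApp _ _ _ | apply Df.all | apply Df.ex | apply Df.and |
    apply Df.or | apply Df.iff | apply Df.not | apply Df.imp

theorem Df.rSurj (i j k : ℕ) : Df.{u} (fun S e => rSurj S (e i) (e j) (e k)) := by
  unfold _root_.rSurj
  repeat' first | exact Df.mem _ _ | exact Df.eq _ _ | exact Df.rApp _ _ _ | exact Df.rFun _ | apply Df.all | apply Df.ex | apply Df.and |
    apply Df.or | apply Df.iff | apply Df.not | apply Df.imp




def STr (S : Set ZFSet.{u}) : Prop := ∀ x ∈ S, ∀ y ∈ x, y ∈ S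
def SSub (S : Set ZFSet.{u}) : Prop := ∀ x ∈ S, ∀ y, y ⊆ x → y ∈ S

theorem rSub_iff {S : Set ZFSet.{u}} (hS : STr S) {x y : ZFSet.{u}} (hx : x ∈ S) :
    rSub S x y ↔ x ⊆ y :=
  ⟨fun h u hu => h u (hS x hx u hu) hu, fun h u _ hu => h hu⟩

theorem rTrans_iff {S : Set ZFSet.{u}} (hS : STr S) {x : ZFSet.{u}} (hx : x ∈ S) :
    rTrans S x ↔ x.IsTransitive :=
  ⟨fun h u hu => (rSub_iff hS (hS x hx u hu)).1 (h u (hS x hx u hu) hu),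
    fun h u hu' hu => (rSub_iff hS hu').2 (h u hu)⟩

theorem rOrd_iff {S : Set ZFSet.{u}} (hS : STr S) {x : ZFSet.{u}} (hx : x ∈ S) :
    rOrd S x ↔ x.IsOrdinal := by
  rw [ZFSet.isOrdinal_iff_forall_mem_isTransitive]
  refine and_congr (rTrans_iff hS hx) ⟨fun h u hu => ?_, fun h u hu' hu => ?_⟩
  · exact (rTrans_iff hS (hS x hx u hu)).1 (h u (hS x hx u hu) hu)
  · exact (rTrans_iff hS hu').2 (h u hu)

theorem rUp_iff {S : Set ZFSet.{u}} (hS : STr S) {w x y : ZFSet.{u}} (hw : w ∈ S) :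
    rUp S w x y ↔ w = {x, y} := by
  constructor
  · rintro ⟨h1, h2, h3⟩
    ext u
    rw [ZFSet.mem_pair]
    refine ⟨fun hu => h3 u (hS w hw u hu) hu, ?_⟩
    rintro (rfl | rfl) <;> assumption
  · rintro rfl
    exact ⟨by simp, by simp, fun u _ hu => by simpa using hu⟩

theorem rPair_iff {S : Set ZFSet.{u}} (hS : STr S) {p x y : ZFSet.{u}} (hp : p ∈ S) :
    rPair S p x y ↔ p = ZFSet.pair x y := by
  have hsx : ({x, x} : ZFSet) = {x} := ZFSet.pair_eq_singleton x
  constructor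
  · rintro ⟨⟨w, hw, hwp, h1⟩, ⟨w', hw', hwp', h2⟩, h3⟩
    rw [rUp_iff hS hw, hsx] at h1
    rw [rUp_iff hS hw'] at h2
    subst h1 h2
    ext u
    simp only [ZFSet.pair, ZFSet.mem_pair]
    constructor
    · intro hu
      have hu' := hS p hp u hu
      have := h3 u hu' hu
      rwa [rUp_iff hS hu', rUp_iff hS hu', hsx] at this
    · rintro (rfl | rfl) <;> assumption
  · intro h
    have h1 : {x} ∈ p := by rw [h]; simp [ZFSet.pair]
    have h2 : {x, y} ∈ p := by rw [h]; simp [ZFSet.pair]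
    refine ⟨⟨_, hS p hp _ h1, h1, ?_⟩, ⟨_, hS p hp _ h2, h2, ?_⟩, fun u hu' hu => ?_⟩
    · rw [rUp_iff hS (hS p hp _ h1), hsx]
    · rw [rUp_iff hS (hS p hp _ h2)]
    · rw [rUp_iff hS hu', rUp_iff hS hu', hsx]
      rw [h] at hu
      simpa [ZFSet.pair] using hu

theorem rApp_iff {S : Set ZFSet.{u}} (hS : STr S) {f x y : ZFSet.{u}} (hf : f ∈ S) :
    rApp S f x y ↔ ZFSet.pair x y ∈ f := by
  constructor
  · rintro ⟨p, hp, hpf, h⟩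
    rw [rPair_iff hS hp] at h
    rwa [← h]
  · intro h
    exact ⟨_, hS f hf _ h, h, (rPair_iff hS (hS f hf _ h)).2 rfl⟩

theorem STr.pair {S : Set ZFSet.{u}} (hS : STr S) {x y : ZFSet.{u}} (h : ZFSet.pair x y ∈ S) :
    x ∈ S ∧ y ∈ S := by
  have h2 : {x, y} ∈ S := hS _ h _ (by simp [ZFSet.pair])
  exact ⟨hS _ h2 _ (by simp), hS _ h2 _ (by simp)⟩

def FunZ (f : ZFSet.{u}) : Prop :=
  ∀ x y y', ZFSet.pair x y ∈ f → ZFSet.pair x y' ∈ f → y = y'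

def SurjZ (f a b : ZFSet.{u}) : Prop :=
  FunZ f ∧ ∀ y ∈ b, ∃ x ∈ a, ZFSet.pair x y ∈ f

theorem rFun_iff {S : Set ZFSet.{u}} (hS : STr S) {f : ZFSet.{u}} (hf : f ∈ S) :
    rFun S f ↔ FunZ f := by
  unfold rFun FunZ
  simp only [rApp_iff hS hf]
  constructor
  · intro h x y y' h1 h2
    exact h x (hS.pair (hS f hf _ h1)).1 y (hS.pair (hS f hf _ h1)).2 y'
      (hS.pair (hS f hf _ h2)).2 h1 h2
  · intro h x _ y _ y' _ h1 h2
    exact h x y y' h1 h2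

theorem rSurj_iff {S : Set ZFSet.{u}} (hS : STr S) {f a b : ZFSet.{u}} (hf : f ∈ S)
    (hb : b ∈ S) : rSurj S f a b ↔ SurjZ f a b := by
  unfold rSurj SurjZ
  rw [rFun_iff hS hf]
  simp only [rApp_iff hS hf]
  refine and_congr Iff.rfl ⟨fun h y hy => ?_, fun h y _ hy => ?_⟩
  · obtain ⟨x, -, h1, h2⟩ := h y (hS b hb y hy) hy
    exact ⟨x, h1, h2⟩
  · obtain ⟨x, h1, h2⟩ := h y hy
    exact ⟨x, (hS.pair (hS f hf _ h2)).1, h1, h2⟩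


theorem mk_toSet (x : ZFSet.{u}) : #x.toSet = lift.{u + 1, u} x.card :=
  ZFSet.cardinalMk_coe_sort

theorem mk_toSet_lt {x y : ZFSet.{u}} : #x.toSet < #y.toSet ↔ x.card < y.card := by
  rw [mk_toSet, mk_toSet, lift_lt]

theorem zOrd_iff {x : ZFSet.{u}} : ZOrd x ↔ x.IsOrdinal :=
  ZFSet.isOrdinal_iff_forall_mem_isTransitive.symm

theorem zCard_iff {x : ZFSet.{u}} : ZCard x ↔ x.IsOrdinal ∧ ∀ y ∈ x, y.card < x.card := by
  unfold ZCard
  simp only [zOrd_iff, mk_toSet_lt]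

theorem mem_HSet {x θ : ZFSet.{u}} :
    x ∈ HSet θ ↔ ∃ t : ZFSet.{u}, t.IsTransitive ∧ x ⊆ t ∧ t.card < θ.card := by
  unfold HSet
  simp only [mk_toSet_lt]
  rfl

theorem HSet_tr (θ : ZFSet.{u}) : STr (HSet θ) := by
  intro x hx y hy
  rw [mem_HSet] at hx ⊢
  obtain ⟨t, h1, h2, h3⟩ := hx
  exact ⟨t, h1, h1 _ (h2 hy), h3⟩

theorem HSet_sub (θ : ZFSet.{u}) : SSub (HSet θ) := by
  intro x hx y hy
  rw [mem_HSet] at hx ⊢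
  obtain ⟨t, h1, h2, h3⟩ := hx
  exact ⟨t, h1, fun _ h => h2 (hy h), h3⟩

theorem card_lt_of_mem_HSet {x θ : ZFSet.{u}} (h : x ∈ HSet θ) : x.card < θ.card := by
  rw [mem_HSet] at h
  obtain ⟨t, h1, h2, h3⟩ := h
  exact (ZFSet.card_mono h2).trans_lt h3

theorem ZCard.mem_iff {κ x : ZFSet.{u}} (hκ : ZCard κ) (hx : x.IsOrdinal) :
    x ∈ κ ↔ x.card < κ.card := by
  rw [zCard_iff] at hκ
  refine ⟨hκ.2 x, fun h => ?_⟩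
  by_contra h'
  exact (ZFSet.card_mono ((hx.notMem_iff_subset hκ.1).1 h')).not_gt h

theorem surjZ_iff {a b : ZFSet.{u}} :
    (∃ f, f ⊆ ZFSet.prod a b ∧ SurjZ f a b) ↔ b.card ≤ a.card := by
  constructor
  · rintro ⟨f, -, h1, h2⟩
    choose! g hg hg' using h2
    rw [← lift_le.{u + 1}, ← ZFSet.cardinalMk_coe_sort, ← ZFSet.cardinalMk_coe_sort]
    refine Cardinal.mk_le_of_injective (f := fun y : b => (⟨g y, hg y y.2⟩ : a)) ?_
    rintro ⟨y, hy⟩ ⟨y', hy'⟩ h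
    simp only [Subtype.mk.injEq] at h
    have e1 := hg' y hy
    have e2 := hg' y' hy'
    rw [← h] at e2
    exact Subtype.ext (h1 _ _ _ e1 e2)
  · intro h
    rw [← lift_le.{u + 1}, ← ZFSet.cardinalMk_coe_sort, ← ZFSet.cardinalMk_coe_sort] at h
    obtain ⟨g, hg⟩ := h
    refine ⟨ZFSet.sep (fun p => ∃ y : b, p = ZFSet.pair (g y) y) (ZFSet.prod a b),
      ZFSet.sep_subset, ?_, ?_⟩
    · intro x y y' h1 h2
      simp only [ZFSet.mem_sep, ZFSet.pair_inj] at h1 h2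
      obtain ⟨-, z, hz, rfl⟩ := h1
      obtain ⟨-, z', hz', rfl⟩ := h2
      have := hg (Subtype.ext (hz.symm.trans hz'))
      rw [this]
    · intro y hy
      refine ⟨g ⟨y, hy⟩, (g ⟨y, hy⟩).2, ?_⟩
      rw [ZFSet.mem_sep]
      exact ⟨ZFSet.pair_mem_prod.2 ⟨(g ⟨y, hy⟩).2, hy⟩, ⟨y, hy⟩, rfl⟩

theorem exists_rank_eq {t : ZFSet.{u}} (ht : t.IsTransitive) {o : Ordinal.{u}}
    (ho : o < t.rank) : ∃ y ∈ t, y.rank = o := by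
  by_contra! hne
  have key : ∀ y : ZFSet.{u}, y ∈ t → ¬ o ≤ y.rank := by
    intro y
    induction y using ZFSet.inductionOn with
    | _ y ih =>
      intro hy hoy
      obtain ⟨z, hz, hoz⟩ := ZFSet.lt_rank_iff.1 (lt_of_le_of_ne hoy (hne y hy).symm)
      exact ih z hz (ht y hy hz) hoz
  obtain ⟨y, hy, hoy⟩ := ZFSet.lt_rank_iff.1 ho
  exact key y hy hoy

theorem card_rank_le {t : ZFSet.{u}} (ht : t.IsTransitive) : t.rank.card ≤ t.card := by
  have h1 : ∀ o : Set.Iio t.rank, ∃ y : t, (y : ZFSet).rank = o := fun o => by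
    obtain ⟨y, hy, h⟩ := exists_rank_eq ht o.2
    exact ⟨⟨y, hy⟩, h⟩
  choose g hg using h1
  have := Cardinal.mk_le_of_injective (f := g) (fun a b hab => by
    apply Subtype.ext
    rw [← hg a, ← hg b, hab])
  rwa [mk_Iio_ordinal, ZFSet.cardinalMk_coe_sort, lift_le] at this

theorem rank_lt_of_mem_HSet {θ x : ZFSet.{u}} (hθ : ZCard θ) (hx : x ∈ HSet θ) :
    x.rank < θ.rank := by
  rw [mem_HSet] at hx
  obtain ⟨t, h1, h2, h3⟩ := hx
  refine (ZFSet.rank_mono h2).trans_lt ?_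
  have : t.rank.toZFSet ∈ θ := by
    rw [hθ.mem_iff (ZFSet.isOrdinal_toZFSet _), Ordinal.card_toZFSet]
    exact (card_rank_le h1).trans_lt h3
  simpa using ZFSet.rank_lt_of_mem this

theorem exists_big_card (δ : Ordinal.{u}) :
    ∃ θ : ZFSet.{u}, ZCard θ ∧ (∀ x : ZFSet.{u}, x.rank ≤ δ → x ∈ HSet θ) ∧
      ∀ x : ZFSet.{u}, x.IsOrdinal → x.rank ≤ δ → x ∈ θ := by
  let c := Order.succ (ZFSet.vonNeumann δ).card
  have hc : (c.ord.toZFSet).card = c := by rw [Ordinal.card_toZFSet, card_ord]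
  have h1 : ZCard c.ord.toZFSet := by
    rw [zCard_iff]
    refine ⟨ZFSet.isOrdinal_toZFSet _, fun y hy => ?_⟩
    obtain ⟨a, ha, rfl⟩ := Ordinal.mem_toZFSet_iff.1 hy
    rw [hc, Ordinal.card_toZFSet]
    exact lt_ord.1 ha
  have h2 : ∀ x : ZFSet.{u}, x.rank ≤ δ → x ∈ HSet c.ord.toZFSet := by
    intro x hx
    rw [mem_HSet, hc]
    exact ⟨ZFSet.vonNeumann δ, ZFSet.isTransitive_vonNeumann _, ZFSet.subset_vonNeumann.2 hx,
      Order.lt_succ _⟩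
  exact ⟨_, h1, h2, fun x hx hr => (h1.mem_iff hx).2 (card_lt_of_mem_HSet (h2 x hr))⟩


def rLev (S : Set ZFSet.{u}) (a : ZFSet.{u}) : Prop :=
  ∃ h ∈ S, ∀ v ∈ S, (v ∈ h ∨ v = a) →
    ∀ x ∈ S, (x ∈ v ↔ ∃ w ∈ S, w ∈ h ∧ w ∈ v ∧ rSub S x w)

theorem Df.rLev (i : ℕ) : Df.{u} (fun S e => rLev S (e i)) := by
  unfold _root_.rLev
  repeat' first | exact Df.mem _ _ | exact Df.eq _ _ | exact Df.rSub _ _ | apply Df.all |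
    apply Df.ex | apply Df.and | apply Df.or | apply Df.iff | apply Df.not | apply Df.imp

theorem rLev_iff {S : Set ZFSet.{u}} (hS : STr S) (hS' : SSub S) {a : ZFSet.{u}} (ha : a ∈ S) :
    rLev S a ↔ a = ZFSet.vonNeumann a.rank := by
  constructor
  · rintro ⟨h, hh, H⟩
    have key : ∀ v, v ∈ S → (v ∈ h ∨ v = a) → v = ZFSet.vonNeumann v.rank := by
      intro v
      induction v using ZFSet.inductionOn with
      | _ v ih =>
        intro hv hva
        refine subset_antisymm (ZFSet.subset_vonNeumann_self v) ?_
        intro x hx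
        rw [ZFSet.mem_vonNeumann, ZFSet.lt_rank_iff] at hx
        obtain ⟨y, hy, hxy⟩ := hx
        obtain ⟨w, hw, hwh, hwv, hyw⟩ := (H v hv hva y (hS v hv y hy)).1 hy
        rw [rSub_iff hS (hS v hv y hy)] at hyw
        have hw2 := ih w hwv hw (Or.inl hwh)
        have hxw : x ⊆ w := by
          rw [hw2, ZFSet.subset_vonNeumann]
          exact hxy.trans (ZFSet.rank_mono hyw)
        exact (H v hv hva x (hS' w hw x hxw)).2 ⟨w, hw, hwh, hwv,
          (rSub_iff hS (hS' w hw x hxw)).2 hxw⟩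
    exact key a ha (Or.inr rfl)
  · intro haV
    refine ⟨ZFSet.sep (fun v => v = ZFSet.vonNeumann v.rank) a, hS' a ha _ ZFSet.sep_subset, ?_⟩
    intro v hv hva x hx
    have hvV : v = ZFSet.vonNeumann v.rank := by
      rcases hva with h | rfl
      · exact (ZFSet.mem_sep.1 h).2
      · exact haV
    have hva' : v ⊆ a := by
      rcases hva with h | rfl
      · rw [haV]
        have := (ZFSet.mem_sep.1 h).1
        rw [haV] at this
        exact ZFSet.isTransitive_vonNeumann _ _ this
      · rfl
    constructor
    · intro hxv
      have hw : ZFSet.vonNeumann x.rank ∈ v := by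
        rw [hvV, ZFSet.vonNeumann_mem_vonNeumann_iff]
        exact ZFSet.rank_lt_of_mem hxv
      refine ⟨_, hS v hv _ hw, ?_, hw, ?_⟩
      · rw [ZFSet.mem_sep, ZFSet.rank_vonNeumann]
        exact ⟨hva' hw, rfl⟩
      · rw [rSub_iff hS hx]
        exact ZFSet.subset_vonNeumann_self x
    · rintro ⟨w, hw, -, hwv, hxw⟩
      rw [rSub_iff hS hx] at hxw
      rw [hvV]
      rw [hvV] at hwv
      exact ZFSet.mem_vonNeumann_of_subset hxw hwv


theorem sat_congr {P : Set ZFSet.{u}} {E : ZFSet.{u} → ZFSet.{u} → Prop} {S : Set ZFSet.{u}}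
    (φ : SF) : ∀ {v w : ℕ → ZFSet.{u}}, (∀ i ∈ φ.fv, v i = w i) →
      (Sat P E S φ v ↔ Sat P E S φ w) := by
  induction φ with
  | mem i j => intro v w h; simp only [Sat]; rw [h i (by simp [SF.fv]), h j (by simp [SF.fv])]
  | eq i j => intro v w h; simp only [Sat]; rw [h i (by simp [SF.fv]), h j (by simp [SF.fv])]
  | pred i => intro v w h; simp only [Sat]; rw [h i (by simp [SF.fv])]
  | not φ ih => intro v w h; simp only [Sat]; rw [ih h]
  | and φ ψ ih1 ih2 =>
    intro v w h
    simp only [Sat]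
    rw [ih1 fun i hi => h i (Or.inl hi), ih2 fun i hi => h i (Or.inr hi)]
  | ex k φ ih =>
    intro v w h
    simp only [Sat]
    refine exists_congr fun x => and_congr Iff.rfl (ih fun i hi => ?_)
    by_cases hik : i = k
    · subst hik; simp
    · rw [Function.update_of_ne hik, Function.update_of_ne hik]
      exact h i ⟨hi, hik⟩

theorem fv_bdd (φ : SF) : ∃ n, ∀ i ∈ φ.fv, i < n := by
  induction φ with
  | mem i j => exact ⟨max i j + 1, by simp [SF.fv]⟩
  | eq i j => exact ⟨max i j + 1, by simp [SF.fv]⟩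
  | pred i => exact ⟨i + 1, by simp [SF.fv]⟩
  | not φ ih => exact ih
  | and φ ψ ih1 ih2 =>
    obtain ⟨n, hn⟩ := ih1
    obtain ⟨m, hm⟩ := ih2
    refine ⟨max n m, fun i hi => ?_⟩
    rcases hi with hi | hi
    · have := hn i hi; omega
    · have := hm i hi; omega
  | ex k φ ih =>
    obtain ⟨n, hn⟩ := ih
    exact ⟨n, fun i hi => hn i hi.1⟩



inductive setRel : ℕ → Type
  | mem : setRel 2

def setLang : FirstOrder.Language.{0, 0} := ⟨fun _ => Empty, setRel⟩

@[reducible]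
def setLangStr (M : Set ZFSet.{u}) : setLang.Structure M where
  funMap := fun f => Empty.elim f
  RelMap := fun {n} (r : setRel n) => match n, r with
    | _, .mem => fun x => (x 0 : ZFSet.{u}) ∈ (x 1 : ZFSet.{u})

def memSym : setLang.Relations 2 := setRel.mem

noncomputable def toFO : SF → setLang.Formula ℕ
  | .mem i j => FirstOrder.Language.Relations.formula₂ (L := setLang) memSym
      (FirstOrder.Language.var i) (FirstOrder.Language.var j)
  | .eq i j => FirstOrder.Language.Term.equal (FirstOrder.Language.var i)
      (FirstOrder.Language.var j)
  | .pred _ => ⊥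
  | .not φ => (toFO φ).not
  | .and φ ψ => toFO φ ⊓ toFO ψ
  | .ex k φ => FirstOrder.Language.Formula.iExs Unit
      (FirstOrder.Language.Formula.relabel
        (fun i => if i = k then Sum.inr () else Sum.inl i) (toFO φ))

theorem toFO_iff (N : Type (u + 1)) (ι : N → ZFSet.{u}) (hι : Function.Injective ι)
    (str : setLang.Structure N)
    (hstr : ∀ x : Fin 2 → N, str.RelMap memSym x ↔ ι (x 0) ∈ ι (x 1)) (φ : SF) :
    ∀ v : ℕ → N, (toFO φ).Realize v ↔ SatIn ∅ (Set.range ι) φ (fun i => ι (v i)) := by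
  induction φ with
  | mem i j =>
    intro v
    rw [toFO, FirstOrder.Language.Formula.realize_rel₂]
    exact hstr _
  | eq i j =>
    intro v
    rw [toFO, FirstOrder.Language.Formula.realize_equal]
    simp [SatIn, Sat, hι.eq_iff]
  | pred i =>
    intro v
    simp [toFO, SatIn, Sat, FirstOrder.Language.Formula.realize_bot]
  | not φ ih =>
    intro v
    rw [toFO, FirstOrder.Language.Formula.realize_not]
    exact not_congr (ih v)
  | and φ ψ ih1 ih2 =>
    intro v
    rw [toFO, FirstOrder.Language.Formula.realize_inf]
    exact and_congr (ih1 v) (ih2 v)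
  | ex k φ ih =>
    intro v
    rw [toFO, FirstOrder.Language.Formula.realize_iExs]
    simp only [FirstOrder.Language.Formula.realize_relabel, ih]
    have key : ∀ x : Unit → N, (fun i => ι (((Sum.elim v x) ∘
        fun i => if i = k then Sum.inr () else Sum.inl i) i)) =
        Function.update (fun i => ι (v i)) k (ι (x ())) := by
      intro x
      funext i
      by_cases h : i = k
      · subst h; simp
      · simp [h]
    simp only [key]
    constructor
    · rintro ⟨x, hx⟩
      exact ⟨ι (x ()), ⟨_, rfl⟩, hx⟩
    · rintro ⟨_, ⟨x, rfl⟩, hx⟩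
      exact ⟨fun _ => x, hx⟩

theorem lowenheim (M s : Set ZFSet.{u}) (hs : s ⊆ M) (c : Cardinal.{u + 1}) (h1 : ℵ₀ ≤ c)
    (h2 : #s ≤ c) (h3 : c ≤ #M) : ∃ Y : Set ZFSet.{u}, s ⊆ Y ∧ #Y = c ∧ ElemSub ∅ Y M := by
  let _ := setLangStr M
  have hcard : setLang.card ≤ ℵ₀ := by
    have : Countable setLang.Symbols := by
      have i1 : Countable (Σ l, setLang.Functions l) := by
        have : IsEmpty (Σ l, setLang.Functions l) := ⟨fun x => Empty.elim x.2⟩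
        infer_instance
      have i2 : Countable (Σ l, setLang.Relations l) := by
        have : Subsingleton (Σ l, setLang.Relations l) := ⟨by
          rintro ⟨_, ⟨⟩⟩ ⟨_, ⟨⟩⟩; rfl⟩
        infer_instance
      exact inferInstanceAs (Countable (_ ⊕ _))
    exact Cardinal.mk_le_aleph0
  obtain ⟨Y, hY1, hY2⟩ := FirstOrder.Language.exists_elementarySubstructure_card_eq setLang
    (M := M) (Subtype.val ⁻¹' s) c h1 (by
      rw [lift_id, lift_id]
      refine le_trans ?_ h2
      exact Cardinal.mk_preimage_of_injective _ _ Subtype.val_injective) (by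
      refine (lift_le.2 hcard).trans ?_
      rw [lift_aleph0]
      simpa using h1) (by simpa using h3)
  refine ⟨Subtype.val '' (Y : Set M), ?_, ?_, ?_, ?_⟩
  · intro x hx
    exact ⟨⟨x, hs hx⟩, hY1 hx, rfl⟩
  · rw [Cardinal.mk_image_eq Subtype.val_injective]
    simpa using hY2
  · rintro _ ⟨x, -, rfl⟩
    exact x.2
  · intro φ v hv
    choose w hw hw' using hv
    obtain rfl : (fun i => (w i : ZFSet)) = v := funext hw'
    have e1 := toFO_iff M Subtype.val Subtype.val_injective _ (fun x => Iff.rfl) φ w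
    rw [Subtype.range_coe] at e1
    have e2 := toFO_iff Y (fun y => ((y : M) : ZFSet.{u}))
      (fun a b h => Subtype.ext (Subtype.ext h)) _ (fun x => Iff.rfl) φ (fun i => ⟨w i, hw i⟩)
    have e3 : Set.range (fun y : Y => ((y : M) : ZFSet.{u})) = Subtype.val '' (Y : Set M) := by
      ext x
      constructor
      · rintro ⟨y, rfl⟩
        exact ⟨y, y.2, rfl⟩
      · rintro ⟨y, hy, rfl⟩
        exact ⟨⟨y, hy⟩, rfl⟩
    rw [e3] at e2
    have e := Y.subtype.map_formula (toFO φ) (fun i => (⟨w i, hw i⟩ : Y))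
    have e' : (⇑Y.subtype ∘ fun i => (⟨w i, hw i⟩ : Y)) = w := rfl
    rw [e'] at e
    exact e2.symm.trans (e.symm.trans e1)



theorem rank_zpair (a b : ZFSet.{u}) :
    (ZFSet.pair a b).rank = Order.succ (Order.succ (max a.rank b.rank)) := by
  have h : ∀ x y : Ordinal.{u}, Order.succ (max x y) = max (Order.succ x) (Order.succ y) :=
    fun x y => Order.succ_mono.map_max
  simp only [ZFSet.pair, ZFSet.rank_pair, ZFSet.rank_singleton, h]
  simp

theorem rank_zpair_lt {a b : ZFSet.{u}} {o : Ordinal.{u}} (ha : a.rank < o) (hb : b.rank < o) :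
    (ZFSet.pair a b).rank < o + 2 := by
  have h2 : (2 : Ordinal.{u}) = 1 + 1 := by norm_num
  rw [rank_zpair, h2, ← add_assoc]
  simpa [Order.succ_lt_succ_iff] using (⟨ha, hb⟩ : _ ∧ _)


structure Emb (θ κ' θ' : ZFSet.{u}) (X : Set ZFSet.{u}) (j : ZFSet.{u} → ZFSet.{u}) : Prop where
  sub : ElemSub ∅ X (HSet θ')
  emb : ElemEmbOn ∅ X (HSet θ) j
  fix : ∀ β ∈ κ', j β = β
  subX : ∀ β ∈ κ', β ∈ X
  memX : κ' ∈ X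

section
variable {θ κ' θ' : ZFSet.{u}} {X : Set ZFSet.{u}} {j : ZFSet.{u} → ZFSet.{u}}

theorem Emb.tr0 (E : Emb θ κ' θ' X j) {P : Set ZFSet.{u} → (ℕ → ZFSet.{u}) → Prop} (h : Df P)
    {e : ℕ → ZFSet.{u}} (he : ∀ i, e i ∈ X) : P X e ↔ P (HSet θ) (fun i => j (e i)) :=
  h.transfer fun φ => E.emb.2 φ e he

theorem Emb.tr1 (E : Emb θ κ' θ' X j) {P : Set ZFSet.{u} → (ℕ → ZFSet.{u}) → Prop} (h : Df P)
    {e : ℕ → ZFSet.{u}} (he : ∀ i, e i ∈ X) : P X e ↔ P (HSet θ') e :=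
  h.transfer fun φ => E.sub.2 φ e he

def vec4 (a b c d : ZFSet.{u}) : ℕ → ZFSet.{u}
  | 0 => a
  | 1 => b
  | 2 => c
  | _ => d

theorem vec4_mem {a b c d : ZFSet.{u}} (ha : a ∈ X) (hb : b ∈ X) (hc : c ∈ X) (hd : d ∈ X)
    (i : ℕ) : vec4 a b c d i ∈ X := by
  match i with
  | 0 => exact ha
  | 1 => exact hb
  | 2 => exact hc
  | _ + 3 => exact hd

theorem Emb.tr (E : Emb θ κ' θ' X j)
    (Q : Set ZFSet.{u} → ZFSet.{u} → ZFSet.{u} → ZFSet.{u} → ZFSet.{u} → Prop)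
    (h : Df (fun S e => Q S (e 0) (e 1) (e 2) (e 3)))
    {a b c d : ZFSet.{u}} (ha : a ∈ X) (hb : b ∈ X) (hc : c ∈ X) (hd : d ∈ X) :
    Q (HSet θ') a b c d ↔ Q (HSet θ) (j a) (j b) (j c) (j d) :=
  (E.tr1 h (vec4_mem ha hb hc hd)).symm.trans (E.tr0 h (vec4_mem ha hb hc hd))

theorem Emb.ex (E : Emb θ κ' θ' X j)
    (Q : Set ZFSet.{u} → ZFSet.{u} → ZFSet.{u} → ZFSet.{u} → ZFSet.{u} → Prop)
    (h : Df (fun S e => Q S (e 0) (e 1) (e 2) (e 3)))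
    {b c d : ZFSet.{u}} (hb : b ∈ X) (hc : c ∈ X) (hd : d ∈ X)
    (hx : ∃ x ∈ HSet θ, Q (HSet θ) x (j b) (j c) (j d)) :
    ∃ x ∈ X, Q (HSet θ) (j x) (j b) (j c) (j d) := by
  have h' : Df (fun S e => ∃ x ∈ S, Q S x (e 0) (e 1) (e 2)) := Df.ex h
  have := (E.tr0 h' (vec4_mem hb hc hd hd)).2 hx
  obtain ⟨x, hxX, hxQ⟩ := this
  exact ⟨x, hxX, (E.tr0 h (vec4_mem hxX hb hc hd)).1 hxQ⟩

theorem Emb.mem (E : Emb θ κ' θ' X j) {a b : ZFSet.{u}} (ha : a ∈ X) (hb : b ∈ X) :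
    a ∈ b ↔ j a ∈ j b :=
  E.tr (fun _ a b _ _ => a ∈ b) (Df.mem 0 1) ha hb hb hb

def rLevAt (S : Set ZFSet.{u}) (v b : ZFSet.{u}) : Prop := rLev S v ∧ rSub S b v ∧ b ∉ v

theorem Df.rLevAt (i k : ℕ) : Df.{u} (fun S e => rLevAt S (e i) (e k)) :=
  (Df.rLev i).and ((Df.rSub k i).and (Df.mem k i).not)

theorem rLevAt_iff {S : Set ZFSet.{u}} (hS : STr S) (hS' : SSub S) {v b : ZFSet.{u}} (hv : v ∈ S)
    (hb : b ∈ S) : rLevAt S v b ↔ v = ZFSet.vonNeumann b.rank := by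
  unfold rLevAt
  rw [rLev_iff hS hS' hv, rSub_iff hS hb]
  constructor
  · rintro ⟨h1, h2, h3⟩
    rw [h1, ZFSet.subset_vonNeumann] at h2
    rw [h1, ZFSet.mem_vonNeumann, not_lt] at h3
    rw [h1, le_antisymm h2 h3]
  · rintro rfl
    rw [ZFSet.rank_vonNeumann]
    exact ⟨rfl, ZFSet.subset_vonNeumann_self b, by simp [ZFSet.mem_vonNeumann]⟩

end

theorem ord_eq_of_rank {a b : ZFSet.{u}} (ha : a.IsOrdinal) (hb : b.IsOrdinal)
    (h : a.rank = b.rank) : a = b := by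
  rw [← ha.toZFSet_rank_eq, ← hb.toZFSet_rank_eq, h]

def EmbProp (κ : ZFSet.{u}) : Prop :=
  ∀ θ : ZFSet.{u}, ZCard θ → κ ∈ θ → ∀ z ∈ HSet θ,
        ∃ (κ' θ' : ZFSet.{u}) (X : Set ZFSet.{u}) (j : ZFSet.{u} → ZFSet.{u}),
          ZCard κ' ∧ ZCard θ' ∧ κ' ∈ θ' ∧ θ' ∈ κ ∧
          ElemSub ∅ X (HSet θ') ∧ ElemEmbOn ∅ X (HSet θ) j ∧
          (∀ β ∈ κ', β ∈ X) ∧ κ' ∈ X ∧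
          (∀ β ∈ κ', j β = β) ∧ j κ' = κ ∧ ∃ x ∈ X, j x = z

theorem EmbProp.card_level {κ : ZFSet.{u}} (hκ : ZCard κ) (H : EmbProp κ) {β : ZFSet.{u}}
    (hβ : β ∈ κ) : (ZFSet.vonNeumann β.rank).card < κ.card := by
  have hκo : κ.IsOrdinal := (zCard_iff.1 hκ).1
  have hβo : β.IsOrdinal := hκo.mem hβ
  obtain ⟨θ, hθ, hθ1, hθ2⟩ := exists_big_card κ.rank
  have hw : ZFSet.vonNeumann β.rank ∈ HSet θ := hθ1 _ (by
    rw [ZFSet.rank_vonNeumann]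
    exact (ZFSet.rank_lt_of_mem hβ).le)
  obtain ⟨κ', θ', X, j, hκ', hθ', hκθ, hθκ, h1, h2, h3, h4, h5, h6, x, hx, hxz⟩ :=
    H θ hθ (hθ2 κ hκo le_rfl) _ hw
  have E : Emb θ κ' θ' X j := ⟨h1, h2, h5, h3, h4⟩
  have hβH : β ∈ HSet θ := hθ1 _ (ZFSet.rank_lt_of_mem hβ).le
  obtain ⟨b, hbX, hb1, hb2⟩ := E.ex (fun S b x _ _ => rOrd S b ∧ rLevAt S x b)
    ((Df.rOrd 0).and (Df.rLevAt 1 0)) hx hx hx ⟨β, hβH, (rOrd_iff (HSet_tr _) hβH).2 hβo, by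
      rw [hxz, rLevAt_iff (HSet_tr _) (HSet_sub _) hw hβH]⟩
  have hjb : j b ∈ HSet θ := E.emb.1 b hbX
  have hjx : j x ∈ HSet θ := E.emb.1 x hx
  rw [rOrd_iff (HSet_tr _) hjb] at hb1
  have hb2' := hb2
  rw [rLevAt_iff (HSet_tr _) (HSet_sub _) hjx hjb, hxz] at hb2
  have hjbβ : j b = β := by
    refine ord_eq_of_rank hb1 hβo ?_
    have := congrArg ZFSet.rank hb2
    simpa using this.symm
  have hbκ : b ∈ κ' := by
    rw [E.mem hbX h4, hjbβ, h6]
    exact hβ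
  rw [h5 b hbκ] at hjbβ
  subst hjbβ
  have := (E.tr (fun S x b _ _ => rLevAt S x b) (Df.rLevAt 0 1) hx hbX hx hx).2 hb2'
  have hxH := E.sub.1 hx
  rw [rLevAt_iff (HSet_tr _) (HSet_sub _) hxH (E.sub.1 hbX)] at this
  rw [← this]
  exact (card_lt_of_mem_HSet hxH).trans ((zCard_iff.1 hκ).2 _ hθκ)

theorem Df.relativize (φ : SF) : ∀ (c : ℕ) (σ : ℕ → ℕ),
    Df.{u} (fun S e => SatIn ∅ {x | x ∈ S ∧ x ∈ e c} φ (fun i => e (σ i))) := by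
  induction φ with
  | mem i j => exact fun c σ => Df.mem _ _
  | eq i j => exact fun c σ => Df.eq _ _
  | pred i => exact fun c σ => Df.true.not.congr fun S e => by simp [SatIn, Sat]
  | not φ ih => exact fun c σ => (ih c σ).not
  | and φ ψ ih1 ih2 => exact fun c σ => (ih1 c σ).and (ih2 c σ)
  | ex k φ ih =>
    intro c σ
    refine (Df.ex (P := fun S e x => x ∈ e c ∧ SatIn ∅ {x | x ∈ S ∧ x ∈ e c} φ
      (fun i => if i = k then x else e (σ i))) ((Df.mem _ _).and ?_)).congr ?_
    · refine (ih (c + 1) (fun i => if i = k then 0 else σ i + 1)).congr fun S e => ?_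
      have : (fun i => e (if i = k then 0 else σ i + 1)) =
          (fun i => if i = k then e 0 else e (σ i + 1)) := by
        funext i
        split_ifs <;> rfl
      rw [this]
    · intro S e
      have : ∀ x, (fun i => if i = k then x else e (σ i)) =
          Function.update (fun i => e (σ i)) k x := by
        intro x
        funext i
        by_cases h : i = k
        · subst h; simp
        · simp [h]
      simp only [this]
      simp only [SatIn, Sat, Set.mem_ofPred_eq, and_assoc]

theorem EmbProp.shrewd {κ : ZFSet.{u}} (hκ : ZCard κ) (H : EmbProp κ) : Shrewd κ := by
  refine ⟨hκ, fun φ α A hφ hα hA hsat => ?_⟩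
  have hκo : κ.IsOrdinal := (zCard_iff.1 hκ).1
  set W := ZFSet.vonNeumann (κ.rank + α.rank) with hW
  set δ := max (ZFSet.pair A W).rank (κ.rank + 2) with hδ
  obtain ⟨θ, hθ, hθ1, hθ2⟩ := exists_big_card δ
  have hκδ : κ.rank ≤ δ := le_max_of_le_right le_self_add
  have hz : ZFSet.pair A W ∈ HSet θ := hθ1 _ (le_max_left _ _)
  obtain ⟨κ', θ', X, j, hκ', hθ', hκθ, hθκ, h1, h2, h3, h4, h5, h6, x, hx, hxz⟩ :=
    H θ hθ (hθ2 κ hκo hκδ) _ hz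
  have E : Emb θ κ' θ' X j := ⟨h1, h2, h5, h3, h4⟩
  have hκ'o : κ'.IsOrdinal := (zCard_iff.1 hκ').1
  have hθ'o : θ'.IsOrdinal := (zCard_iff.1 hθ').1
  have hκ'κ : κ' ∈ κ := hκo.mem_trans hκθ hθκ
  have hS := HSet_tr θ
  have hS' := HSet_sub θ
  have hT := HSet_tr θ'
  have hT' := HSet_sub θ'
  have hAH : A ∈ HSet θ := (hS.pair hz).1
  have hWH : W ∈ HSet θ := (hS.pair hz).2
  have hκH : κ ∈ HSet θ := hθ1 _ hκδ
  obtain ⟨A', hA'X, W₁, -, hA'⟩ := E.ex (fun S a x _ _ => ∃ b ∈ S, rPair S x a b)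
    (Df.ex (Df.rPair _ _ _)) hx hx hx ⟨A, hAH, W, hWH, by rw [hxz, rPair_iff hS hz]⟩
  obtain ⟨W', hW'X, hW'⟩ := E.ex (fun S b x a _ => rPair S x a b)
    (Df.rPair 1 2 0) hx hA'X hx ⟨W₁, by
      rw [hxz, rPair_iff hS hz] at hA'
      exact (ZFSet.pair_injective hA').2 ▸ hWH, hA'⟩
  rw [hxz, rPair_iff hS hz] at hW'
  obtain ⟨hjA, hjW⟩ := ZFSet.pair_injective hW'
  have hV0H : ZFSet.vonNeumann κ.rank ∈ HSet θ := hθ1 _ (by simpa using hκδ)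
  obtain ⟨V', hV'X, hV'⟩ := E.ex (fun S b x _ _ => rLevAt S b x)
    (Df.rLevAt 0 1) h4 hx hx ⟨ZFSet.vonNeumann κ.rank, hV0H, by
      rw [h6, rLevAt_iff hS hS' hV0H hκH]⟩
  have hV'2 := (E.tr (fun S b x _ _ => rLevAt S b x) (Df.rLevAt 0 1) hV'X h4 h4 h4).2 hV'
  rw [h6, rLevAt_iff hS hS' (E.emb.1 _ hV'X) hκH] at hV'
  rw [rLevAt_iff hT hT' (E.sub.1 hV'X) (E.sub.1 h4)] at hV'2
  have hW'lev : W' = ZFSet.vonNeumann W'.rank := by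
    rw [← rLev_iff hT hT' (E.sub.1 hW'X),
      E.tr (fun S b _ _ _ => rLev S b) (Df.rLev 0) hW'X h4 h4 h4, ← hjW, rLev_iff hS hS' hWH, hW,
      ZFSet.rank_vonNeumann]
  have hκW' : κ'.rank ≤ W'.rank := by
    rw [← ZFSet.subset_vonNeumann, ← hW'lev, ← rSub_iff hT (E.sub.1 h4),
      E.tr (fun S b c _ _ => rSub S b c) (Df.rSub 0 1) h4 hW'X h4 h4, ← hjW, h6,
      rSub_iff hS hκH, hW, ZFSet.subset_vonNeumann]
    exact le_self_add
  have hlim : ∀ ξ ∈ κ', ∃ η ∈ κ', ξ ∈ η := by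
    intro ξ hξ
    obtain ⟨η, hη, h7, h8⟩ := E.ex (fun S η k ξ _ => η ∈ k ∧ ξ ∈ η)
      ((Df.mem _ _).and (Df.mem _ _)) h4 (h3 ξ hξ) h4 ⟨κ', hS _ hκH _ hκ'κ, by
        rw [h6]; exact hκ'κ, by rw [h5 ξ hξ]; exact hξ⟩
    rw [← E.mem hη h4] at h7
    rw [← E.mem (h3 ξ hξ) hη] at h8
    exact ⟨η, h7, h8⟩
  have hlev : ∀ β ∈ κ', ZFSet.vonNeumann β.rank ∈ X ∧
      j (ZFSet.vonNeumann β.rank) = ZFSet.vonNeumann β.rank ∧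
      ∀ y ∈ ZFSet.vonNeumann β.rank, y ∈ X ∧ ∃ u ∈ X, j u = y := by
    intro β hβ
    have hβX := h3 β hβ
    have hβκ : β ∈ κ := hκo.mem_trans hβ hκ'κ
    have hβH : β ∈ HSet θ := hS _ hκH _ hβκ
    have hVH : ZFSet.vonNeumann β.rank ∈ HSet θ := hθ1 _ (by
      rw [ZFSet.rank_vonNeumann]
      exact (ZFSet.rank_lt_of_mem hβκ).le.trans hκδ)
    obtain ⟨v, hv, hv1⟩ := E.ex (fun S b x _ _ => rLevAt S b x)
      (Df.rLevAt 0 1) hβX hx hx ⟨ZFSet.vonNeumann β.rank, hVH, by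
        rw [h5 β hβ, rLevAt_iff hS hS' hVH hβH]⟩
    have hv2 := (E.tr (fun S b x _ _ => rLevAt S b x) (Df.rLevAt 0 1) hv hβX h4 h4).2 hv1
    rw [h5 β hβ, rLevAt_iff hS hS' (E.emb.1 _ hv) hβH] at hv1
    rw [rLevAt_iff hT hT' (E.sub.1 hv) (E.sub.1 hβX)] at hv2
    subst hv2
    refine ⟨hv, hv1, ?_⟩
    have hcard := H.card_level hκ hβκ
    set Vβ := ZFSet.vonNeumann β.rank with hVβ
    set l := Vβ.card.ord.toZFSet with hl
    have hlc : l.card = Vβ.card := by rw [hl, Ordinal.card_toZFSet, card_ord]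
    have hlκ : l ∈ κ := by
      rw [hκ.mem_iff (ZFSet.isOrdinal_toZFSet _), hlc]
      exact hcard
    obtain ⟨f, hf1, hf2⟩ := surjZ_iff.2 hlc.ge
    have hfH : f ∈ HSet θ := by
      refine hθ1 _ (le_max_of_le_right ?_)
      rw [ZFSet.rank_le_iff]
      intro p hp
      have := hf1 hp
      rw [ZFSet.mem_prod] at this
      obtain ⟨a, ha, b, hb, rfl⟩ := this
      exact rank_zpair_lt ((ZFSet.rank_lt_of_mem ha).trans (ZFSet.rank_lt_of_mem hlκ))
        ((ZFSet.mem_vonNeumann.1 hb).trans (ZFSet.rank_lt_of_mem hβκ))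
    have hlH := hS _ hκH _ hlκ
    obtain ⟨l', hl'X, hl'κ, hl'⟩ := E.ex (fun S l k v _ => l ∈ k ∧ ∃ f ∈ S, rSurj S f l v)
      ((Df.mem _ _).and (Df.ex (Df.rSurj _ _ _))) h4 hv h4 ⟨l, hlH, by rw [h6]; exact hlκ,
        f, hfH, by rw [hv1, rSurj_iff hS hfH hVH]; exact hf2⟩
    rw [← E.mem hl'X h4] at hl'κ
    obtain ⟨f', hf'X, hf'⟩ := E.ex (fun S f l v _ => rSurj S f l v) (Df.rSurj _ _ _)
      hl'X hv hv hl'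
    have hf'2 := (E.tr (fun S f l v _ => rSurj S f l v) (Df.rSurj _ _ _) hf'X hl'X hv hv).2 hf'
    have hjf'H := E.emb.1 f' hf'X
    have hf'H := E.sub.1 hf'X
    rw [rSurj_iff hS hjf'H (E.emb.1 _ hv), hv1, h5 l' hl'κ] at hf'
    rw [rSurj_iff hT hf'H (E.sub.1 hv)] at hf'2
    intro y hy
    constructor
    · obtain ⟨ξ, hξ, hξy⟩ := hf'2.2 y hy
      have hξκ := hκ'o.mem_trans hξ hl'κ
      have hξX := h3 ξ hξκ
      have e1 : ∃ u ∈ HSet θ', rApp (HSet θ') f' ξ u :=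
        ⟨y, hT _ (E.sub.1 hv) _ hy, (rApp_iff hT hf'H).2 hξy⟩
      rw [E.tr (fun S f ξ _ _ => ∃ u ∈ S, rApp S f ξ u) (Df.ex (Df.rApp _ _ _)) hf'X hξX hξX hξX]
        at e1
      obtain ⟨w, hwX, hw⟩ := E.ex (fun S u f ξ _ => rApp S f ξ u) (Df.rApp _ _ _) hf'X hξX hξX e1
      rw [← E.tr (fun S u f ξ _ => rApp S f ξ u) (Df.rApp _ _ _) hwX hf'X hξX hξX,
        rApp_iff hT hf'H] at hw
      rw [hf'2.1 _ _ _ hξy hw]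
      exact hwX
    · obtain ⟨ξ, hξ, hξy⟩ := hf'.2 y hy
      have hξκ := hκ'o.mem_trans hξ hl'κ
      have hξX := h3 ξ hξκ
      obtain ⟨w, hwX, hw⟩ := E.ex (fun S u f ξ _ => rApp S f ξ u) (Df.rApp _ _ _) hf'X hξX hξX
        ⟨y, hS _ hVH _ hy, by rw [h5 ξ hξκ, rApp_iff hS hjf'H]; exact hξy⟩
      rw [rApp_iff hS hjf'H, h5 ξ hξκ] at hw
      exact ⟨w, hwX, hf'.1 _ _ _ hw hξy⟩
  have hlev' : ∀ y : ZFSet.{u}, y.rank < κ'.rank → ∃ β ∈ κ', y ∈ ZFSet.vonNeumann β.rank := by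
    intro y hy
    have : y.rank.toZFSet ∈ κ' := by
      rw [← (ZFSet.isOrdinal_toZFSet _).rank_lt_iff_mem hκ'o]
      simpa using hy
    obtain ⟨η, hη, h⟩ := hlim _ this
    refine ⟨η, hη, ?_⟩
    rw [ZFSet.mem_vonNeumann]
    simpa using ZFSet.rank_lt_of_mem h
  have hVX : ∀ y : ZFSet.{u}, y.rank < κ'.rank → y ∈ X := by
    intro y hy
    obtain ⟨β, hβ, h⟩ := hlev' y hy
    exact ((hlev β hβ).2.2 y h).1
  have hid : ∀ y : ZFSet.{u}, y.rank < κ'.rank → j y = y := by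
    intro y
    induction y using ZFSet.inductionOn with
    | _ y ih =>
      intro hy
      obtain ⟨β, hβ, h⟩ := hlev' y hy
      have hyX := hVX y hy
      obtain ⟨g1, g2, g3⟩ := hlev β hβ
      ext w
      constructor
      · intro hw
        have hjy : j y ∈ ZFSet.vonNeumann β.rank := by
          rw [← g2, ← E.mem hyX g1]
          exact h
        obtain ⟨-, s, hsX, rfl⟩ := g3 w (ZFSet.isTransitive_vonNeumann _ _ hjy hw)
        rw [← E.mem hsX hyX] at hw
        rw [ih s hw ((ZFSet.rank_lt_of_mem hw).trans hy)]
        exact hw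
      · intro hw
        have hwr := (ZFSet.rank_lt_of_mem hw).trans hy
        have hw2 := (E.mem (hVX w hwr) hyX).1 hw
        rw [ih w hw hwr] at hw2
        exact hw2
  have hA'eq : A' = Vres A κ' := by
    have hA'V : A' ⊆ V' := by
      rw [← rSub_iff hT (E.sub.1 hA'X),
        E.tr (fun S b c _ _ => rSub S b c) (Df.rSub 0 1) hA'X hV'X h4 h4, ← hjA,
        rSub_iff hS hAH, hV']
      intro y hy
      rw [ZFSet.mem_vonNeumann]
      exact hA y hy
    ext y
    unfold Vres
    rw [ZFSet.mem_sep]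
    have key : y.rank < κ'.rank → (y ∈ A' ↔ y ∈ A) := by
      intro hy
      rw [E.mem (hVX y hy) hA'X, ← hjA, hid y hy]
    constructor
    · intro h
      have := hA'V h
      rw [hV'2, ZFSet.mem_vonNeumann] at this
      exact ⟨(key this).1 h, this⟩
    · rintro ⟨h, h'⟩
      exact (key h').2 h
  have hαo : κ'.rank + (W'.rank - κ'.rank) = W'.rank := Ordinal.add_sub_cancel_of_le hκW'
  refine ⟨κ', (W'.rank - κ'.rank).toZFSet, hκ'κ, ?_, ?_⟩
  · rw [← (ZFSet.isOrdinal_toZFSet _).rank_lt_iff_mem hκo, Ordinal.rank_toZFSet]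
    exact (Ordinal.sub_le_self _ _).trans_lt ((rank_lt_of_mem_HSet hθ' (E.sub.1 hW'X)).trans
      (ZFSet.rank_lt_of_mem hθκ))
  · rw [Ordinal.rank_toZFSet, hαo, ← hA'eq]
    have main := E.tr (fun S w a k _ => SatIn ∅ {x | x ∈ S ∧ x ∈ w} φ
      (fun i => if i = 0 then a else k)) ((Df.relativize φ 0
        (fun i => if i = 0 then 1 else 2)).congr fun S e => by
          have : (fun i => e (if i = 0 then 1 else 2)) =
              (fun i => if i = 0 then e 1 else e 2) := by
            funext i
            split_ifs <;> rfl
          rw [this]) hW'X hA'X h4 h4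
    have s1 : {x | x ∈ HSet θ' ∧ x ∈ W'} = Vclass W'.rank := by
      ext y
      simp only [Vclass, Set.mem_ofPred_eq]
      rw [← ZFSet.mem_vonNeumann, ← hW'lev]
      exact ⟨fun h => h.2, fun h => ⟨hT _ (E.sub.1 hW'X) _ h, h⟩⟩
    have s2 : {x | x ∈ HSet θ ∧ x ∈ j W'} = Vclass (κ.rank + α.rank) := by
      ext y
      simp only [Vclass, Set.mem_ofPred_eq]
      rw [← ZFSet.mem_vonNeumann, ← hW, ← hjW]
      exact ⟨fun h => h.2, fun h => ⟨hS _ hWH _ h, h⟩⟩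
    have s3 : ∀ (S : Set ZFSet.{u}) (a k : ZFSet.{u}), SatIn ∅ S φ (val2 a k) ↔
        SatIn ∅ S φ (fun i => if i = 0 then a else k) := by
      intro S a k
      refine sat_congr φ fun i hi => ?_
      have := hφ hi
      simp only [Set.mem_insert_iff, Set.mem_singleton_iff] at this
      rcases this with rfl | rfl <;> simp [val2]
    rw [s1, s2, ← hjA, h6] at main
    rw [s3]
    exact main.2 ((s3 _ _ _).1 hsat)




inductive SG : Type
  | mem : ℕ → ℕ → SG
  | eq : ℕ → ℕ → SG
  | nand : SG → SG → SG
  | ex : ℕ → SG → SG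

def SatG (M : Set ZFSet.{u}) : SG → (ℕ → ZFSet.{u}) → Prop
  | .mem i j, v => v i ∈ v j
  | .eq i j, v => v i = v j
  | .nand φ ψ, v => ¬ (SatG M φ v ∧ SatG M ψ v)
  | .ex k φ, v => ∃ x ∈ M, SatG M φ (Function.update v k x)

def toSG : SF → SG
  | .mem i j => .mem i j
  | .eq i j => .eq i j
  | .pred i => .nand (.eq i i) (.eq i i)
  | .not φ => .nand (toSG φ) (toSG φ)
  | .and φ ψ => .nand (.nand (toSG φ) (toSG ψ)) (.nand (toSG φ) (toSG ψ))
  | .ex k φ => .ex k (toSG φ)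

theorem satG_toSG (M : Set ZFSet.{u}) (φ : SF) :
    ∀ v, SatG M (toSG φ) v ↔ SatIn ∅ M φ v := by
  induction φ with
  | mem i j => exact fun v => Iff.rfl
  | eq i j => exact fun v => Iff.rfl
  | pred i => intro v; simp [toSG, SatG, SatIn, Sat]
  | not φ ih =>
    intro v
    have := ih v
    simp only [toSG, SatG, SatIn, Sat] at this ⊢
    tauto
  | and φ ψ ih1 ih2 =>
    intro v
    have h1 := ih1 v
    have h2 := ih2 v
    simp only [toSG, SatG, SatIn, Sat] at h1 h2 ⊢
    tauto
  | ex k φ ih =>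
    intro v
    simp only [toSG, SatG, ih]
    rfl

theorem satG_bdd (φ : SG) : ∃ n : ℕ, ∀ (M : Set ZFSet.{u}) (v w : ℕ → ZFSet.{u}),
    (∀ i < n, v i = w i) → (SatG M φ v ↔ SatG M φ w) := by
  induction φ with
  | mem i j =>
    refine ⟨max i j + 1, fun M v w h => ?_⟩
    simp only [SatG, h i (by omega), h j (by omega)]
  | eq i j =>
    refine ⟨max i j + 1, fun M v w h => ?_⟩
    simp only [SatG, h i (by omega), h j (by omega)]
  | nand φ ψ ih1 ih2 =>
    obtain ⟨n, hn⟩ := ih1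
    obtain ⟨m, hm⟩ := ih2
    refine ⟨max n m, fun M v w h => ?_⟩
    simp only [SatG, hn M v w fun i hi => h i (by omega), hm M v w fun i hi => h i (by omega)]
  | ex k φ ih =>
    obtain ⟨n, hn⟩ := ih
    refine ⟨n, fun M v w h => ?_⟩
    simp only [SatG]
    refine exists_congr fun x => and_congr Iff.rfl (hn M _ _ fun i hi => ?_)
    by_cases hik : i = k
    · subst hik; simp
    · rw [Function.update_of_ne hik, Function.update_of_ne hik]
      exact h i hi

def tag : ℕ → ZFSet.{u}
  | 0 => ∅
  | n + 1 => {tag n}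

theorem tag_inj : ∀ {m n : ℕ}, tag.{u} m = tag n → m = n
  | 0, 0, _ => rfl
  | 0, n + 1, h => by
    have : tag.{u} n ∈ tag.{u} (n + 1) := ZFSet.mem_singleton.2 rfl
    rw [← h] at this
    exact absurd this (ZFSet.notMem_empty _)
  | n + 1, 0, h => by
    have : tag.{u} n ∈ tag.{u} (n + 1) := ZFSet.mem_singleton.2 rfl
    rw [h] at this
    exact absurd this (ZFSet.notMem_empty _)
  | m + 1, n + 1, h => by
    have : tag.{u} m ∈ tag.{u} (n + 1) := by
      rw [← h]
      exact ZFSet.mem_singleton.2 rfl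
    rw [tag_inj (ZFSet.mem_singleton.1 this)]

theorem rank_tag : ∀ n : ℕ, (tag.{u} n).rank < Ordinal.omega0
  | 0 => by simp [tag]
  | n + 1 => by
    simp only [tag, ZFSet.rank_singleton]
    exact Ordinal.isSuccLimit_omega0.succ_lt (rank_tag n)

def cd (m : ℕ) (x y : ZFSet.{u}) : ZFSet.{u} := ZFSet.pair (tag m) (ZFSet.pair x y)

theorem cd_inj {m n : ℕ} {x y x' y' : ZFSet.{u}} (h : cd m x y = cd n x' y') :
    m = n ∧ x = x' ∧ y = y' := by
  obtain ⟨h1, h2⟩ := ZFSet.pair_injective h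
  exact ⟨tag_inj h1, ZFSet.pair_injective h2⟩

def code : SG → ZFSet.{u}
  | .mem i j => cd 0 (tag i) (tag j)
  | .eq i j => cd 1 (tag i) (tag j)
  | .nand φ ψ => cd 2 (code φ) (code ψ)
  | .ex k φ => cd 3 (tag k) (code φ)

theorem code_inj : ∀ {φ ψ : SG}, code.{u} φ = code ψ → φ = ψ := by
  intro φ
  induction φ with
  | mem i j =>
    intro ψ h
    cases ψ with
    | mem i' j' =>
      obtain ⟨-, h2, h3⟩ := cd_inj h
      rw [tag_inj h2, tag_inj h3]
    | eq i' j' => exact absurd (cd_inj h).1 (by norm_num)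
    | nand a b => exact absurd (cd_inj h).1 (by norm_num)
    | ex k a => exact absurd (cd_inj h).1 (by norm_num)
  | eq i j =>
    intro ψ h
    cases ψ with
    | eq i' j' =>
      obtain ⟨-, h2, h3⟩ := cd_inj h
      rw [tag_inj h2, tag_inj h3]
    | mem i' j' => exact absurd (cd_inj h).1 (by norm_num)
    | nand a b => exact absurd (cd_inj h).1 (by norm_num)
    | ex k a => exact absurd (cd_inj h).1 (by norm_num)
  | nand a b iha ihb =>
    intro ψ h
    cases ψ with
    | nand a' b' =>
      obtain ⟨-, h2, h3⟩ := cd_inj h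
      rw [iha h2, ihb h3]
    | mem i' j' => exact absurd (cd_inj h).1 (by norm_num)
    | eq i' j' => exact absurd (cd_inj h).1 (by norm_num)
    | ex k a => exact absurd (cd_inj h).1 (by norm_num)
  | ex k a ih =>
    intro ψ h
    cases ψ with
    | ex k' a' =>
      obtain ⟨-, h2, h3⟩ := cd_inj h
      rw [tag_inj h2, ih h3]
    | mem i' j' => exact absurd (cd_inj h).1 (by norm_num)
    | eq i' j' => exact absurd (cd_inj h).1 (by norm_num)
    | nand a b => exact absurd (cd_inj h).1 (by norm_num)

theorem rank_zpair_limit {γ : Ordinal.{u}} (hγ : ∀ o < γ, Order.succ o < γ) {a b : ZFSet.{u}}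
    (ha : a.rank < γ) (hb : b.rank < γ) : (ZFSet.pair a b).rank < γ := by
  rw [rank_zpair]
  exact hγ _ (hγ _ (max_lt ha hb))

theorem omega_lim : ∀ o < Ordinal.omega0.{u}, Order.succ o < Ordinal.omega0.{u} :=
  fun _ h => Ordinal.isSuccLimit_omega0.succ_lt h

theorem rank_code : ∀ φ : SG, (code.{u} φ).rank < Ordinal.omega0
  | .mem i j => rank_zpair_limit omega_lim (rank_tag _)
      (rank_zpair_limit omega_lim (rank_tag _) (rank_tag _))
  | .eq i j => rank_zpair_limit omega_lim (rank_tag _)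
      (rank_zpair_limit omega_lim (rank_tag _) (rank_tag _))
  | .nand φ ψ => rank_zpair_limit omega_lim (rank_tag _)
      (rank_zpair_limit omega_lim (rank_code φ) (rank_code ψ))
  | .ex k φ => rank_zpair_limit omega_lim (rank_tag _)
      (rank_zpair_limit omega_lim (rank_tag _) (rank_code φ))

noncomputable def tags : ZFSet.{u} := ZFSet.range (tag.{u})

theorem mem_tags {x : ZFSet.{u}} : x ∈ tags ↔ ∃ n, tag n = x := by
  simp [tags]

noncomputable def asg (v : ℕ → ZFSet.{u}) : ZFSet.{u} :=
  ZFSet.range (fun n : ℕ => ZFSet.pair (tag n) (v n))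

theorem mem_asg {v : ℕ → ZFSet.{u}} {p : ZFSet.{u}} :
    p ∈ asg v ↔ ∃ n, ZFSet.pair (tag n) (v n) = p := by
  simp [asg]

theorem pair_mem_asg {v : ℕ → ZFSet.{u}} {n : ℕ} {x : ZFSet.{u}} :
    ZFSet.pair (tag n) x ∈ asg v ↔ x = v n := by
  rw [mem_asg]
  constructor
  · rintro ⟨m, h⟩
    obtain ⟨h1, h2⟩ := ZFSet.pair_injective h
    rw [← h2, tag_inj h1]
  · rintro rfl
    exact ⟨n, rfl⟩

theorem asg_inj {v w : ℕ → ZFSet.{u}} (h : asg v = asg w) : v = w := by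
  funext n
  rw [← pair_mem_asg, ← h, pair_mem_asg]

theorem rank_tags : (tags.{u}).rank ≤ Ordinal.omega0 := by
  rw [ZFSet.rank_le_iff]
  intro x hx
  obtain ⟨n, rfl⟩ := mem_tags.1 hx
  exact rank_tag n

theorem rank_asg_le {v : ℕ → ZFSet.{u}} {o : Ordinal.{u}} (ho : Ordinal.omega0 ≤ o)
    (hv : ∀ n, (v n).rank ≤ o) : (asg v).rank ≤ Order.succ (Order.succ (Order.succ o)) := by
  rw [ZFSet.rank_le_iff]
  intro p hp
  obtain ⟨n, rfl⟩ := mem_asg.1 hp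
  rw [rank_zpair, Order.succ_lt_succ_iff, Order.succ_lt_succ_iff, Order.lt_succ_iff]
  exact max_le ((rank_tag n).le.trans ho) (hv n)


def rCode (S : Set ZFSet.{u}) (c m x y : ZFSet.{u}) : Prop :=
  ∃ q ∈ S, rPair S c m q ∧ rPair S q x y

theorem Df.rCode (i j k l : ℕ) : Df.{u} (fun S e => rCode S (e i) (e j) (e k) (e l)) := by
  unfold _root_.rCode
  exact Df.ex ((Df.rPair _ _ _).and (Df.rPair _ _ _))

def rAsg (S : Set ZFSet.{u}) (M I t : ZFSet.{u}) : Prop :=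
  rFun S t ∧ (∀ i ∈ S, i ∈ I → ∃ x ∈ S, x ∈ M ∧ rApp S t i x) ∧
    ∀ p ∈ S, p ∈ t → ∃ i ∈ S, ∃ x ∈ S, i ∈ I ∧ x ∈ M ∧ rPair S p i x

theorem Df.rAsg (i j k : ℕ) : Df.{u} (fun S e => rAsg S (e i) (e j) (e k)) := by
  unfold _root_.rAsg
  repeat' first | exact Df.mem _ _ | exact Df.eq _ _ | exact Df.rFun _ | exact Df.rApp _ _ _ |
    exact Df.rPair _ _ _ | apply Df.all |
    apply Df.ex | apply Df.and | apply Df.or | apply Df.iff | apply Df.not | apply Df.imp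

def rVar (S : Set ZFSet.{u}) (I k t t' : ZFSet.{u}) : Prop :=
  ∀ i ∈ S, i ∈ I → ¬ i = k → ∀ x ∈ S, (rApp S t i x ↔ rApp S t' i x)

theorem Df.rVar (i j k l : ℕ) : Df.{u} (fun S e => rVar S (e i) (e j) (e k) (e l)) := by
  unfold _root_.rVar
  repeat' first | exact Df.mem _ _ | exact Df.eq _ _ | exact Df.rFun _ | exact Df.rApp _ _ _ |
    exact Df.rPair _ _ _ | apply Df.all |
    apply Df.ex | apply Df.and | apply Df.or | apply Df.iff | apply Df.not | apply Df.imp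

def rMemC (S : Set ZFSet.{u}) (M I C T m : ZFSet.{u}) : Prop :=
  ∀ i ∈ S, ∀ j ∈ S, i ∈ I → j ∈ I → ∃ c ∈ S, c ∈ C ∧ rCode S c m i j ∧
    ∀ t ∈ S, rAsg S M I t → (rApp S T c t ↔
      ∃ x ∈ S, ∃ y ∈ S, rApp S t i x ∧ rApp S t j y ∧ x ∈ y)

theorem Df.rMemC (i1 i2 i3 i4 i5 : ℕ) :
    Df.{u} (fun S e => rMemC S (e i1) (e i2) (e i3) (e i4) (e i5)) := by
  unfold _root_.rMemC
  repeat' first | exact Df.mem _ _ | exact Df.eq _ _ | exact Df.rApp _ _ _ | exact Df.rAsg _ _ _ |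
    exact Df.rCode _ _ _ _ | exact Df.rVar _ _ _ _ | apply Df.all |
    apply Df.ex | apply Df.and | apply Df.or | apply Df.iff | apply Df.not | apply Df.imp

def rEqC (S : Set ZFSet.{u}) (M I C T m : ZFSet.{u}) : Prop :=
  ∀ i ∈ S, ∀ j ∈ S, i ∈ I → j ∈ I → ∃ c ∈ S, c ∈ C ∧ rCode S c m i j ∧
    ∀ t ∈ S, rAsg S M I t → (rApp S T c t ↔ ∃ x ∈ S, rApp S t i x ∧ rApp S t j x)

theorem Df.rEqC (i1 i2 i3 i4 i5 : ℕ) :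
    Df.{u} (fun S e => rEqC S (e i1) (e i2) (e i3) (e i4) (e i5)) := by
  unfold _root_.rEqC
  repeat' first | exact Df.mem _ _ | exact Df.eq _ _ | exact Df.rApp _ _ _ | exact Df.rAsg _ _ _ |
    exact Df.rCode _ _ _ _ | exact Df.rVar _ _ _ _ | apply Df.all |
    apply Df.ex | apply Df.and | apply Df.or | apply Df.iff | apply Df.not | apply Df.imp

def rNandC (S : Set ZFSet.{u}) (M I C T m : ZFSet.{u}) : Prop :=
  ∀ d ∈ S, ∀ d' ∈ S, d ∈ C → d' ∈ C → ∃ c ∈ S, c ∈ C ∧ rCode S c m d d' ∧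
    ∀ t ∈ S, rAsg S M I t → (rApp S T c t ↔ ¬ (rApp S T d t ∧ rApp S T d' t))

theorem Df.rNandC (i1 i2 i3 i4 i5 : ℕ) :
    Df.{u} (fun S e => rNandC S (e i1) (e i2) (e i3) (e i4) (e i5)) := by
  unfold _root_.rNandC
  repeat' first | exact Df.mem _ _ | exact Df.eq _ _ | exact Df.rApp _ _ _ | exact Df.rAsg _ _ _ |
    exact Df.rCode _ _ _ _ | exact Df.rVar _ _ _ _ | apply Df.all |
    apply Df.ex | apply Df.and | apply Df.or | apply Df.iff | apply Df.not | apply Df.imp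

def rExists (S : Set ZFSet.{u}) (M I T k d t : ZFSet.{u}) : Prop :=
  ∃ t' ∈ S, rAsg S M I t' ∧ rVar S I k t t' ∧ rApp S T d t'

theorem Df.rExists (i1 i2 i3 i4 i5 i6 : ℕ) :
    Df.{u} (fun S e => rExists S (e i1) (e i2) (e i3) (e i4) (e i5) (e i6)) := by
  unfold _root_.rExists
  exact Df.ex ((Df.rAsg _ _ _).and ((Df.rVar _ _ _ _).and (Df.rApp _ _ _)))

def rExC (S : Set ZFSet.{u}) (M I C T m : ZFSet.{u}) : Prop :=
  ∀ k ∈ S, ∀ d ∈ S, k ∈ I → d ∈ C → ∃ c ∈ S, c ∈ C ∧ rCode S c m k d ∧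
    ∀ t ∈ S, rAsg S M I t → (rApp S T c t ↔ rExists S M I T k d t)

theorem Df.rExC (i1 i2 i3 i4 i5 : ℕ) :
    Df.{u} (fun S e => rExC S (e i1) (e i2) (e i3) (e i4) (e i5)) := by
  unfold _root_.rExC
  repeat' first | exact Df.mem _ _ | exact Df.eq _ _ | exact Df.rApp _ _ _ | exact Df.rAsg _ _ _ |
    exact Df.rCode _ _ _ _ | exact Df.rExists _ _ _ _ _ _ | apply Df.all |
    apply Df.ex | apply Df.and | apply Df.or | apply Df.iff | apply Df.not | apply Df.imp

def rTV (S : Set ZFSet.{u}) (M R I C T : ZFSet.{u}) : Prop :=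
  ∀ k ∈ S, ∀ d ∈ S, ∀ t ∈ S, k ∈ I → d ∈ C → rAsg S R I t →
    rExists S M I T k d t → rExists S R I T k d t

theorem Df.rTV (i1 i2 i3 i4 i5 : ℕ) :
    Df.{u} (fun S e => rTV S (e i1) (e i2) (e i3) (e i4) (e i5)) := by
  unfold _root_.rTV
  repeat' first | exact Df.mem _ _ | exact Df.eq _ _ | exact Df.rApp _ _ _ | exact Df.rAsg _ _ _ |
    exact Df.rCode _ _ _ _ | exact Df.rExists _ _ _ _ _ _ | apply Df.all |
    apply Df.ex | apply Df.and | apply Df.or | apply Df.iff | apply Df.not | apply Df.imp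

def rACl (S : Set ZFSet.{u}) (A M I C T F : ZFSet.{u}) : Prop :=
  ∀ c ∈ S, ∀ s ∈ S, c ∈ C → rApp S A c s → ∃ t ∈ S, rAsg S M I t ∧ rApp S T c t ∧
    ∀ i ∈ S, i ∈ I → ∃ b ∈ S, ∃ x ∈ S, rApp S s i b ∧ rApp S F b x ∧ rApp S t i x

theorem Df.rACl (i1 i2 i3 i4 i5 i6 : ℕ) :
    Df.{u} (fun S e => rACl S (e i1) (e i2) (e i3) (e i4) (e i5) (e i6)) := by
  unfold _root_.rACl
  repeat' first | exact Df.mem _ _ | exact Df.eq _ _ | exact Df.rApp _ _ _ | exact Df.rAsg _ _ _ |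
    exact Df.rCode _ _ _ _ | exact Df.rExists _ _ _ _ _ _ | apply Df.all |
    apply Df.ex | apply Df.and | apply Df.or | apply Df.iff | apply Df.not | apply Df.imp

def rFCl (S : Set ZFSet.{u}) (κ M F R V m2 m3 : ZFSet.{u}) : Prop :=
  rFun S F ∧ (∀ β ∈ S, β ∈ κ → rApp S F β β) ∧ rApp S F m2 κ ∧ (∃ x ∈ S, rApp S F m3 x) ∧
    (∀ b ∈ S, ∀ x ∈ S, rApp S F b x → b ∈ V ∧ x ∈ M) ∧ rLevAt S V κ ∧
    ∀ x ∈ S, (x ∈ R ↔ ∃ b ∈ S, rApp S F b x)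

theorem Df.rFCl (i1 i2 i3 i4 i5 i6 i7 : ℕ) :
    Df.{u} (fun S e => rFCl S (e i1) (e i2) (e i3) (e i4) (e i5) (e i6) (e i7)) := by
  unfold _root_.rFCl
  repeat' first | exact Df.mem _ _ | exact Df.eq _ _ | exact Df.rApp _ _ _ | exact Df.rFun _ |
    exact Df.rLevAt _ _ | apply Df.all |
    apply Df.ex | apply Df.and | apply Df.or | apply Df.iff | apply Df.not | apply Df.imp

def rLt (S : Set ZFSet.{u}) (a b : ZFSet.{u}) : Prop := ¬ ∃ f ∈ S, rSurj S f a b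

theorem Df.rLt (i j : ℕ) : Df.{u} (fun S e => rLt S (e i) (e j)) := by
  unfold _root_.rLt
  exact (Df.ex (Df.rSurj _ _ _)).not

def rCard (S : Set ZFSet.{u}) (a : ZFSet.{u}) : Prop :=
  rOrd S a ∧ ∀ b ∈ S, b ∈ a → rLt S b a

theorem Df.rCard (i : ℕ) : Df.{u} (fun S e => rCard S (e i)) := by
  unfold _root_.rCard
  exact (Df.rOrd _).and (Df.all ((Df.mem _ _).imp (Df.rLt _ _)))

def rHH (S : Set ZFSet.{u}) (M θ : ZFSet.{u}) : Prop :=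
  ∀ x ∈ S, (x ∈ M ↔ ∃ t ∈ S, rTrans S t ∧ rSub S x t ∧ rLt S t θ)

theorem Df.rHH (i j : ℕ) : Df.{u} (fun S e => rHH S (e i) (e j)) := by
  unfold _root_.rHH
  exact Df.all ((Df.mem _ _).iff (Df.ex ((Df.rTrans _).and ((Df.rSub _ _).and (Df.rLt _ _)))))

def rEmp (S : Set ZFSet.{u}) (x : ZFSet.{u}) : Prop := ∀ y ∈ S, ¬ y ∈ x

theorem Df.rEmp (i : ℕ) : Df.{u} (fun S e => rEmp S (e i)) := by
  unfold _root_.rEmp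
  exact Df.all (Df.mem _ _).not

def rTags (S : Set ZFSet.{u}) (I m0 m1 m2 m3 : ZFSet.{u}) : Prop :=
  (∀ x ∈ S, (x ∈ I ↔ rEmp S x ∨ ∃ y ∈ S, y ∈ I ∧ rUp S x y y)) ∧
    rEmp S m0 ∧ rUp S m1 m0 m0 ∧ rUp S m2 m1 m1 ∧ rUp S m3 m2 m2

theorem Df.rTags (i1 i2 i3 i4 i5 : ℕ) :
    Df.{u} (fun S e => rTags S (e i1) (e i2) (e i3) (e i4) (e i5)) := by
  unfold _root_.rTags
  repeat' first | exact Df.mem _ _ | exact Df.eq _ _ | exact Df.rUp _ _ _ | exact Df.rEmp _ |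
    exact Df.rLevAt _ _ | apply Df.all |
    apply Df.ex | apply Df.and | apply Df.or | apply Df.iff | apply Df.not | apply Df.imp

def rLim (S : Set ZFSet.{u}) (x : ZFSet.{u}) : Prop :=
  (∃ y ∈ S, y ∈ x) ∧ ∀ y ∈ S, y ∈ x → ∃ z ∈ S, z ∈ x ∧ y ∈ z

theorem Df.rLim (i : ℕ) : Df.{u} (fun S e => rLim S (e i)) := by
  unfold _root_.rLim
  repeat' first | exact Df.mem _ _ | exact Df.eq _ _ | apply Df.all |
    apply Df.ex | apply Df.and | apply Df.or | apply Df.iff | apply Df.not | apply Df.imp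

def rMain (S : Set ZFSet.{u}) (A κ θ M I C T F R V m0 m1 m2 m3 : ZFSet.{u}) : Prop :=
  (∀ x ∈ S, ∃ y ∈ S, x ∈ y) ∧ rCard S κ ∧ rCard S θ ∧ κ ∈ θ ∧ rHH S M θ ∧
  (rLim S κ ∧ ∃ x ∈ S, x ∈ κ ∧ rLim S x) ∧ rTags S I m0 m1 m2 m3 ∧
  rFCl S κ M F R V m2 m3 ∧ rMemC S M I C T m0 ∧ rEqC S M I C T m1 ∧ rNandC S M I C T m2 ∧
  rExC S M I C T m3 ∧ rTV S M R I C T ∧ rACl S A M I C T F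

def rPhi (S : Set ZFSet.{u}) (A κ : ZFSet.{u}) : Prop :=
  ∃ θ ∈ S, ∃ M ∈ S, ∃ I ∈ S, ∃ C ∈ S, ∃ T ∈ S, ∃ F ∈ S, ∃ R ∈ S, ∃ V ∈ S,
    ∃ m0 ∈ S, ∃ m1 ∈ S, ∃ m2 ∈ S, ∃ m3 ∈ S, rMain S A κ θ M I C T F R V m0 m1 m2 m3

theorem Df.rPhi (i j : ℕ) : Df.{u} (fun S e => rPhi S (e i) (e j)) := by
  unfold _root_.rPhi _root_.rMain
  repeat' first | exact Df.mem _ _ | exact Df.rCard _ | exact Df.rHH _ _ | exact Df.rLim _ |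
    exact Df.rTags _ _ _ _ _ | exact Df.rFCl _ _ _ _ _ _ _ | exact Df.rMemC _ _ _ _ _ |
    exact Df.rEqC _ _ _ _ _ | exact Df.rNandC _ _ _ _ _ | exact Df.rExC _ _ _ _ _ |
    exact Df.rTV _ _ _ _ _ | exact Df.rACl _ _ _ _ _ _ | apply Df.all |
    apply Df.ex | apply Df.and | apply Df.or | apply Df.iff | apply Df.not | apply Df.imp



theorem Vclass_tr (γ : Ordinal.{u}) : STr (Vclass γ) :=
  fun _ hx _ hy => lt_trans (ZFSet.rank_lt_of_mem hy) hx

theorem Vclass_sub (γ : Ordinal.{u}) : SSub (Vclass γ) :=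
  fun _ hx _ hy => lt_of_le_of_lt (ZFSet.rank_mono hy) hx

theorem rank_prod_le (a b : ZFSet.{u}) :
    (ZFSet.prod a b).rank ≤ Order.succ (Order.succ (max a.rank b.rank)) := by
  rw [ZFSet.rank_le_iff]
  intro p hp
  rw [ZFSet.mem_prod] at hp
  obtain ⟨x, hx, y, hy, rfl⟩ := hp
  rw [rank_zpair, Order.succ_lt_succ_iff, Order.succ_lt_succ_iff]
  exact max_lt_max (ZFSet.rank_lt_of_mem hx) (ZFSet.rank_lt_of_mem hy)

section

theorem V_pair
    {γ : Ordinal.{u}} (hγ : ∀ o < γ, Order.succ o < γ)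
    {x y : ZFSet.{u}} (hx : x ∈ Vclass γ) (hy : y ∈ Vclass γ) :
    ZFSet.pair x y ∈ Vclass γ := rank_zpair_limit hγ hx hy

theorem V_prod
    {γ : Ordinal.{u}} (hγ : ∀ o < γ, Order.succ o < γ)
    {x y : ZFSet.{u}} (hx : x ∈ Vclass γ) (hy : y ∈ Vclass γ) :
    ZFSet.prod x y ∈ Vclass γ :=
  (rank_prod_le x y).trans_lt (hγ _ (hγ _ (max_lt hx hy)))

theorem V_asg
    {γ : Ordinal.{u}} (hγ : ∀ o < γ, Order.succ o < γ)
    {M : ZFSet.{u}} (hM : M ∈ Vclass γ) (hI : tags ∈ Vclass γ) {v : ℕ → ZFSet.{u}}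
    (hv : ∀ n, v n ∈ M) : asg v ∈ Vclass γ := by
  refine Vclass_sub γ _ (V_prod hγ hI hM) _ fun p hp => ?_
  obtain ⟨n, rfl⟩ := mem_asg.1 hp
  exact ZFSet.pair_mem_prod.2 ⟨mem_tags.2 ⟨n, rfl⟩, hv n⟩

theorem V_tag
    {γ : Ordinal.{u}}
    (hI : tags ∈ Vclass γ) (n : ℕ) : tag n ∈ Vclass γ :=
  Vclass_tr γ _ hI _ (mem_tags.2 ⟨n, rfl⟩)

theorem rAsg_iff
    {γ : Ordinal.{u}}
    {M t : ZFSet.{u}} (hI : tags ∈ Vclass γ)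
    (ht : t ∈ Vclass γ) : rAsg (Vclass γ) M tags t ↔ ∃ v, (∀ n, v n ∈ M) ∧ t = asg v := by
  have hS := Vclass_tr γ
  unfold rAsg
  rw [rFun_iff hS ht]
  simp only [rApp_iff hS ht]
  constructor
  · rintro ⟨h1, h2, h3⟩
    have h2' : ∀ n : ℕ, ∃ x ∈ M, ZFSet.pair (tag n) x ∈ t := fun n => by
      obtain ⟨x, -, hx⟩ := h2 (tag n) (V_tag hI n) (mem_tags.2 ⟨n, rfl⟩)
      exact ⟨x, hx⟩
    choose v hv hv' using h2'
    refine ⟨v, hv, ?_⟩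
    ext p
    rw [mem_asg]
    constructor
    · intro hp
      obtain ⟨i, -, x, -, hi, -, hpx⟩ := h3 p (hS t ht p hp) hp
      rw [rPair_iff hS (hS t ht p hp)] at hpx
      obtain ⟨n, rfl⟩ := mem_tags.1 hi
      subst hpx
      exact ⟨n, by rw [h1 _ _ _ hp (hv' n)]⟩
    · rintro ⟨n, rfl⟩
      exact hv' n
  · rintro ⟨v, hv, rfl⟩
    refine ⟨?_, ?_, ?_⟩
    · intro x y y' h1 h2
      obtain ⟨n, hn⟩ := mem_asg.1 h1
      obtain ⟨rfl, -⟩ := ZFSet.pair_injective hn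
      rw [pair_mem_asg] at h1 h2
      rw [h1, h2]
    · intro i hi hi'
      obtain ⟨n, rfl⟩ := mem_tags.1 hi'
      have : ZFSet.pair (tag n) (v n) ∈ asg v := pair_mem_asg.2 rfl
      exact ⟨v n, (hS.pair (hS _ ht _ this)).2, hv n, this⟩
    · intro p hp hpt
      obtain ⟨n, rfl⟩ := mem_asg.1 hpt
      exact ⟨tag n, (hS.pair hp).1, v n, (hS.pair hp).2, mem_tags.2 ⟨n, rfl⟩, hv n,
        (rPair_iff hS hp).2 rfl⟩

theorem allAsg
    {γ : Ordinal.{u}} (hγ : ∀ o < γ, Order.succ o < γ)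
    {M : ZFSet.{u}} (hM : M ∈ Vclass γ) (hI : tags ∈ Vclass γ)
    {P : ZFSet.{u} → Prop} : (∀ t ∈ Vclass γ, rAsg (Vclass γ) M tags t → P t) ↔
      ∀ v : ℕ → ZFSet.{u}, (∀ n, v n ∈ M) → P (asg v) := by
  constructor
  · intro h v hv
    exact h _ (V_asg hγ hM hI hv) ((rAsg_iff hI (V_asg hγ hM hI hv)).2 ⟨v, hv, rfl⟩)
  · intro h t ht ht'
    obtain ⟨v, hv, rfl⟩ := (rAsg_iff hI ht).1 ht'
    exact h v hv

theorem exAsg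
    {γ : Ordinal.{u}} (hγ : ∀ o < γ, Order.succ o < γ)
    {M : ZFSet.{u}} (hM : M ∈ Vclass γ) (hI : tags ∈ Vclass γ)
    {P : ZFSet.{u} → Prop} : (∃ t ∈ Vclass γ, rAsg (Vclass γ) M tags t ∧ P t) ↔
      ∃ v : ℕ → ZFSet.{u}, (∀ n, v n ∈ M) ∧ P (asg v) := by
  constructor
  · rintro ⟨t, ht, ht', h⟩
    obtain ⟨v, hv, rfl⟩ := (rAsg_iff hI ht).1 ht'
    exact ⟨v, hv, h⟩
  · rintro ⟨v, hv, h⟩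
    exact ⟨_, V_asg hγ hM hI hv, (rAsg_iff hI (V_asg hγ hM hI hv)).2 ⟨v, hv, rfl⟩, h⟩

theorem rCode_iff
    {γ : Ordinal.{u}}
    {c : ZFSet.{u}} (hc : c ∈ Vclass γ) {m : ℕ} {x y : ZFSet.{u}} :
    rCode (Vclass γ) c (tag m) x y ↔ c = cd m x y := by
  have hS := Vclass_tr γ
  unfold rCode
  simp only [rPair_iff hS hc]
  constructor
  · rintro ⟨q, hq, rfl, h⟩
    rw [rPair_iff hS hq] at h
    subst h
    rfl
  · rintro rfl
    have : ZFSet.pair x y ∈ Vclass γ := (hS.pair hc).2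
    exact ⟨_, this, rfl, (rPair_iff hS this).2 rfl⟩

theorem exCode
    {γ : Ordinal.{u}}
    {C : ZFSet.{u}} (hC : C ∈ Vclass γ) {m : ℕ} {x y : ZFSet.{u}}
    {P : ZFSet.{u} → Prop} : (∃ c ∈ Vclass γ, c ∈ C ∧ rCode (Vclass γ) c (tag m) x y ∧ P c) ↔
      cd m x y ∈ C ∧ P (cd m x y) := by
  constructor
  · rintro ⟨c, hc, hcC, h, hP⟩
    rw [rCode_iff hc] at h
    subst h
    exact ⟨hcC, hP⟩
  · rintro ⟨h, hP⟩
    have hc := Vclass_tr γ _ hC _ h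
    exact ⟨_, hc, h, (rCode_iff hc).2 rfl, hP⟩

theorem allMem
    {γ : Ordinal.{u}}
    {a : ZFSet.{u}} (ha : a ∈ Vclass γ) {P : ZFSet.{u} → Prop} :
    (∀ x ∈ Vclass γ, x ∈ a → P x) ↔ ∀ x ∈ a, P x :=
  ⟨fun h x hx => h x (Vclass_tr γ _ ha _ hx) hx, fun h x _ hx => h x hx⟩

theorem allTag
    {P : ZFSet.{u} → Prop} : (∀ x ∈ tags, P x) ↔ ∀ n, P (tag n) :=
  ⟨fun h n => h _ (mem_tags.2 ⟨n, rfl⟩), fun h x hx => by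
    obtain ⟨n, rfl⟩ := mem_tags.1 hx
    exact h n⟩

theorem allMem2
    {γ : Ordinal.{u}}
    {a b : ZFSet.{u}} (ha : a ∈ Vclass γ) (hb : b ∈ Vclass γ)
    {P : ZFSet.{u} → ZFSet.{u} → Prop} :
    (∀ x ∈ Vclass γ, ∀ y ∈ Vclass γ, x ∈ a → y ∈ b → P x y) ↔ ∀ x ∈ a, ∀ y ∈ b, P x y :=
  ⟨fun h x hx y hy => h x (Vclass_tr γ _ ha _ hx) y (Vclass_tr γ _ hb _ hy) hx hy,
    fun h x _ y _ hx hy => h x hx y hy⟩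


theorem rMemC_iff
    {γ : Ordinal.{u}} (hγ : ∀ o < γ, Order.succ o < γ)
    {M C T : ZFSet.{u}} (hM : M ∈ Vclass γ) (hI : tags ∈ Vclass γ) (hC : C ∈ Vclass γ)
    (hT : T ∈ Vclass γ)
    : rMemC (Vclass γ) M tags C T (tag 0) ↔ ∀ i j : ℕ,
    cd 0 (tag i) (tag j) ∈ C ∧ ∀ v : ℕ → ZFSet.{u}, (∀ n, v n ∈ M) →
      (ZFSet.pair (cd 0 (tag i) (tag j)) (asg v) ∈ T ↔ v i ∈ v j) := by
  have hS := Vclass_tr γ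
  unfold rMemC
  simp only [allMem2 hI hI, allTag, exCode hC, allAsg hγ hM hI, rApp_iff hS hT]
  refine forall_congr' fun i => forall_congr' fun j => and_congr Iff.rfl
    (forall_congr' fun v => forall_congr' fun hv => iff_congr Iff.rfl ?_)
  simp only [rApp_iff hS (V_asg hγ hM hI hv), pair_mem_asg]
  constructor
  · rintro ⟨x, -, y, -, rfl, rfl, h⟩
    exact h
  · intro h
    exact ⟨_, hS _ hM _ (hv i), _, hS _ hM _ (hv j), rfl, rfl, h⟩

theorem rEqC_iff
    {γ : Ordinal.{u}} (hγ : ∀ o < γ, Order.succ o < γ)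
    {M C T : ZFSet.{u}} (hM : M ∈ Vclass γ) (hI : tags ∈ Vclass γ) (hC : C ∈ Vclass γ)
    (hT : T ∈ Vclass γ)
    : rEqC (Vclass γ) M tags C T (tag 1) ↔ ∀ i j : ℕ,
    cd 1 (tag i) (tag j) ∈ C ∧ ∀ v : ℕ → ZFSet.{u}, (∀ n, v n ∈ M) →
      (ZFSet.pair (cd 1 (tag i) (tag j)) (asg v) ∈ T ↔ v i = v j) := by
  have hS := Vclass_tr γ
  unfold rEqC
  simp only [allMem2 hI hI, allTag, exCode hC, allAsg hγ hM hI, rApp_iff hS hT]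
  refine forall_congr' fun i => forall_congr' fun j => and_congr Iff.rfl
    (forall_congr' fun v => forall_congr' fun hv => iff_congr Iff.rfl ?_)
  simp only [rApp_iff hS (V_asg hγ hM hI hv), pair_mem_asg]
  constructor
  · rintro ⟨x, -, h, h'⟩
    exact h.symm.trans h'
  · intro h
    exact ⟨_, hS _ hM _ (hv i), rfl, h⟩

theorem rNandC_iff
    {γ : Ordinal.{u}} (hγ : ∀ o < γ, Order.succ o < γ)
    {M C T : ZFSet.{u}} (hM : M ∈ Vclass γ) (hI : tags ∈ Vclass γ) (hC : C ∈ Vclass γ)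
    (hT : T ∈ Vclass γ)
    : rNandC (Vclass γ) M tags C T (tag 2) ↔ ∀ d ∈ C, ∀ d' ∈ C,
    cd 2 d d' ∈ C ∧ ∀ v : ℕ → ZFSet.{u}, (∀ n, v n ∈ M) →
      (ZFSet.pair (cd 2 d d') (asg v) ∈ T ↔
        ¬ (ZFSet.pair d (asg v) ∈ T ∧ ZFSet.pair d' (asg v) ∈ T)) := by
  have hS := Vclass_tr γ
  unfold rNandC
  simp only [allMem2 hC hC, exCode hC, allAsg hγ hM hI, rApp_iff hS hT]

theorem rExists_iff
    {γ : Ordinal.{u}} (hγ : ∀ o < γ, Order.succ o < γ)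
    {M T : ZFSet.{u}} (hM : M ∈ Vclass γ) (hI : tags ∈ Vclass γ) (hT : T ∈ Vclass γ)
    {N d : ZFSet.{u}} {k : ℕ} {v : ℕ → ZFSet.{u}}
    (hN : N ∈ Vclass γ) (hv : ∀ n, v n ∈ M) (hv' : ∀ n, v n ∈ N) :
    rExists (Vclass γ) N tags T (tag k) d (asg v) ↔
      ∃ x ∈ N, ZFSet.pair d (asg (Function.update v k x)) ∈ T := by
  have hS := Vclass_tr γ
  unfold rExists
  simp only [exAsg hγ hN hI, rApp_iff hS hT]
  have hvar : ∀ w : ℕ → ZFSet.{u}, (∀ n, w n ∈ N) →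
      (rVar (Vclass γ) tags (tag k) (asg v) (asg w) ↔ w = Function.update v k (w k)) := by
    intro w hw
    unfold rVar
    simp only [allMem hI, allTag, rApp_iff hS (V_asg hγ hM hI hv),
      rApp_iff hS (V_asg hγ hN hI hw), pair_mem_asg]
    constructor
    · intro h
      funext i
      by_cases hik : i = k
      · subst hik; simp
      · rw [Function.update_of_ne hik]
        exact (((h i fun e => hik (tag_inj e)) (v i) (hS _ hM _ (hv i))).1 rfl).symm
    · intro h i hik x _
      have hik' : i ≠ k := fun e => hik (by rw [e])
      rw [h, Function.update_of_ne hik']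
  constructor
  · rintro ⟨w, hw, h1, h2⟩
    rw [hvar w hw] at h1
    rw [h1] at h2
    exact ⟨w k, hw k, h2⟩
  · rintro ⟨x, hx, h⟩
    have hw : ∀ n, Function.update v k x n ∈ N := by
      intro n
      by_cases hnk : n = k
      · subst hnk; simpa using hx
      · rw [Function.update_of_ne hnk]
        exact hv' n
    refine ⟨_, hw, ?_, h⟩
    rw [hvar _ hw]
    simp

theorem rExC_iff
    {γ : Ordinal.{u}} (hγ : ∀ o < γ, Order.succ o < γ)
    {M C T : ZFSet.{u}} (hM : M ∈ Vclass γ) (hI : tags ∈ Vclass γ) (hC : C ∈ Vclass γ)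
    (hT : T ∈ Vclass γ)
    : rExC (Vclass γ) M tags C T (tag 3) ↔ ∀ k : ℕ, ∀ d ∈ C,
    cd 3 (tag k) d ∈ C ∧ ∀ v : ℕ → ZFSet.{u}, (∀ n, v n ∈ M) →
      (ZFSet.pair (cd 3 (tag k) d) (asg v) ∈ T ↔
        ∃ x ∈ M, ZFSet.pair d (asg (Function.update v k x)) ∈ T) := by
  have hS := Vclass_tr γ
  unfold rExC
  simp only [allMem2 hI hC, allTag, exCode hC, allAsg hγ hM hI, rApp_iff hS hT]
  refine forall_congr' fun k => forall_congr' fun d => forall_congr' fun hd => and_congr Iff.rfl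
    (forall_congr' fun v => forall_congr' fun hv => iff_congr Iff.rfl ?_)
  exact rExists_iff hγ hM hI hT hM hv hv

theorem rTV_iff
    {γ : Ordinal.{u}} (hγ : ∀ o < γ, Order.succ o < γ)
    {M C T : ZFSet.{u}} (hM : M ∈ Vclass γ) (hI : tags ∈ Vclass γ) (hC : C ∈ Vclass γ)
    (hT : T ∈ Vclass γ)
    {R : ZFSet.{u}} (hR : R ⊆ M) : rTV (Vclass γ) M R tags C T ↔
    ∀ k : ℕ, ∀ d ∈ C, ∀ v : ℕ → ZFSet.{u}, (∀ n, v n ∈ R) →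
      (∃ x ∈ M, ZFSet.pair d (asg (Function.update v k x)) ∈ T) →
      ∃ x ∈ R, ZFSet.pair d (asg (Function.update v k x)) ∈ T := by
  have hS := Vclass_tr γ
  have hRS := Vclass_sub γ _ hM _ hR
  have key : rTV (Vclass γ) M R tags C T ↔ ∀ k : ℕ, ∀ d ∈ C, ∀ v : ℕ → ZFSet.{u},
      (∀ n, v n ∈ R) → rExists (Vclass γ) M tags T (tag k) d (asg v) →
        rExists (Vclass γ) R tags T (tag k) d (asg v) := by
    unfold rTV
    constructor
    · intro h k d hd
      refine (allAsg hγ hRS hI (P := fun t => rExists (Vclass γ) M tags T (tag k) d t →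
        rExists (Vclass γ) R tags T (tag k) d t)).1 fun t ht ht' => ?_
      exact h _ (V_tag hI k) d (hS _ hC _ hd) t ht (mem_tags.2 ⟨k, rfl⟩) hd ht'
    · intro h k _ d _ t ht hk hd ht'
      obtain ⟨k, rfl⟩ := mem_tags.1 hk
      exact (allAsg hγ hRS hI (P := fun t => rExists (Vclass γ) M tags T (tag k) d t →
        rExists (Vclass γ) R tags T (tag k) d t)).2 (h k d hd) t ht ht'
  rw [key]
  refine forall_congr' fun k => forall_congr' fun d => forall_congr' fun hd =>
    forall_congr' fun v => forall_congr' fun hv => ?_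
  rw [rExists_iff hγ hM hI hT hM (fun n => hR (hv n)) (fun n => hR (hv n)),
    rExists_iff hγ hM hI hT hRS (fun n => hR (hv n)) hv]

theorem rACl_iff
    {γ : Ordinal.{u}} (hγ : ∀ o < γ, Order.succ o < γ)
    {M C T : ZFSet.{u}} (hM : M ∈ Vclass γ) (hI : tags ∈ Vclass γ) (hC : C ∈ Vclass γ)
    (hT : T ∈ Vclass γ)
    {A F : ZFSet.{u}} (hA : A ∈ Vclass γ) (hF : F ∈ Vclass γ) :
    rACl (Vclass γ) A M tags C T F ↔ ∀ c ∈ C, ∀ s, ZFSet.pair c s ∈ A →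
      ∃ v : ℕ → ZFSet.{u}, (∀ n, v n ∈ M) ∧ ZFSet.pair c (asg v) ∈ T ∧
        ∀ n : ℕ, ∃ b, ZFSet.pair (tag n) b ∈ s ∧ ZFSet.pair b (v n) ∈ F := by
  have hS := Vclass_tr γ
  unfold rACl
  simp only [exAsg hγ hM hI, rApp_iff hS hT, rApp_iff hS hA, rApp_iff hS hF, allMem hI, allTag]
  have key : ∀ s ∈ Vclass γ, ∀ v : ℕ → ZFSet.{u}, (∀ n, v n ∈ M) →
      ((∀ n, ∃ b ∈ Vclass γ, ∃ x ∈ Vclass γ, rApp (Vclass γ) s (tag n) b ∧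
        ZFSet.pair b x ∈ F ∧ rApp (Vclass γ) (asg v) (tag n) x) ↔
      ∀ n : ℕ, ∃ b, ZFSet.pair (tag n) b ∈ s ∧ ZFSet.pair b (v n) ∈ F) := by
    intro s hs v hv
    simp only [rApp_iff hS hs, rApp_iff hS (V_asg hγ hM hI hv), pair_mem_asg]
    refine forall_congr' fun n => ⟨?_, ?_⟩
    · rintro ⟨b, -, x, -, h1, h2, rfl⟩
      exact ⟨b, h1, h2⟩
    · rintro ⟨b, h1, h2⟩
      exact ⟨b, (hS.pair (hS _ hF _ h2)).1, _, (hS.pair (hS _ hF _ h2)).2, h1, h2, rfl⟩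
  constructor
  · intro h c hc s hcs
    have hs := (hS.pair (hS _ hA _ hcs)).2
    obtain ⟨v, hv, h1, h2⟩ := h c (hS _ hC _ hc) s hs hc hcs
    exact ⟨v, hv, h1, (key s hs v hv).1 h2⟩
  · intro h c _ s hs hc hcs
    obtain ⟨v, hv, h1, h2⟩ := h c hc s hcs
    exact ⟨v, hv, h1, (key s hs v hv).2 h2⟩

end

section
variable {γ : Ordinal.{u}}

theorem rFCl_iff {κ M F R V m2 m3 : ZFSet.{u}} (hκ : κ ∈ Vclass γ)
    (hF : F ∈ Vclass γ) (hR : R ∈ Vclass γ) (hV : V ∈ Vclass γ) :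
    rFCl (Vclass γ) κ M F R V m2 m3 ↔
      FunZ F ∧ (∀ β ∈ κ, ZFSet.pair β β ∈ F) ∧ ZFSet.pair m2 κ ∈ F ∧
      (∃ x, ZFSet.pair m3 x ∈ F) ∧ (∀ b x, ZFSet.pair b x ∈ F → b ∈ V ∧ x ∈ M) ∧
      V = ZFSet.vonNeumann κ.rank ∧ ∀ x, (x ∈ R ↔ ∃ b, ZFSet.pair b x ∈ F) := by
  have hS := Vclass_tr γ
  unfold rFCl
  simp only [rFun_iff hS hF, rApp_iff hS hF, allMem hκ, rLevAt_iff hS (Vclass_sub γ) hV hκ]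
  refine and_congr Iff.rfl (and_congr Iff.rfl (and_congr Iff.rfl (and_congr ?_ (and_congr ?_
    (and_congr Iff.rfl ?_)))))
  · exact ⟨fun ⟨x, _, h⟩ => ⟨x, h⟩, fun ⟨x, h⟩ => ⟨x, (hS.pair (hS _ hF _ h)).2, h⟩⟩
  · exact ⟨fun h b x hb => h b (hS.pair (hS _ hF _ hb)).1 x (hS.pair (hS _ hF _ hb)).2 hb,
      fun h b _ x _ hb => h b x hb⟩
  · constructor
    · intro h x
      constructor
      · intro hx
        obtain ⟨b, -, hb⟩ := (h x (hS _ hR _ hx)).1 hx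
        exact ⟨b, hb⟩
      · rintro ⟨b, hb⟩
        obtain ⟨h1, h2⟩ := hS.pair (hS _ hF _ hb)
        exact (h x h2).2 ⟨b, h1, hb⟩
    · intro h x _
      rw [h]
      exact ⟨fun ⟨b, hb⟩ => ⟨b, (hS.pair (hS _ hF _ hb)).1, hb⟩, fun ⟨b, _, hb⟩ => ⟨b, hb⟩⟩

theorem rLim_iff {x : ZFSet.{u}} (hx : x ∈ Vclass γ) :
    rLim (Vclass γ) x ↔ (∃ y, y ∈ x) ∧ ∀ y ∈ x, ∃ z ∈ x, y ∈ z := by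
  have hS := Vclass_tr γ
  unfold rLim
  rw [allMem hx]
  refine and_congr ?_ (forall_congr' fun y => forall_congr' fun hy => ?_)
  · exact ⟨fun ⟨y, _, h⟩ => ⟨y, h⟩, fun ⟨y, h⟩ => ⟨y, hS _ hx _ h, h⟩⟩
  · exact ⟨fun ⟨y, _, h⟩ => ⟨y, h⟩, fun ⟨y, h⟩ => ⟨y, hS _ hx _ h.1, h⟩⟩

theorem rEmp_iff {x : ZFSet.{u}} (hx : x ∈ Vclass γ) : rEmp (Vclass γ) x ↔ x = ∅ := by
  unfold rEmp
  rw [ZFSet.eq_empty]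
  exact ⟨fun h y hy => h y (Vclass_tr γ _ hx _ hy) hy, fun h y _ => h y⟩

theorem rTags_iff (hγ : ∀ o < γ, Order.succ o < γ) {I m0 m1 m2 m3 : ZFSet.{u}}
    (hI : I ∈ Vclass γ) (h0 : m0 ∈ Vclass γ) (h1 : m1 ∈ Vclass γ)
    (h2 : m2 ∈ Vclass γ) (h3 : m3 ∈ Vclass γ) : rTags (Vclass γ) I m0 m1 m2 m3 ↔
      I = tags ∧ m0 = tag 0 ∧ m1 = tag 1 ∧ m2 = tag 2 ∧ m3 = tag 3 := by
  have hS := Vclass_tr γ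
  unfold rTags
  rw [rEmp_iff h0, rUp_iff hS h1, rUp_iff hS h2, rUp_iff hS h3]
  simp only [ZFSet.pair_eq_singleton]
  have e1 : m0 = ∅ ∧ m1 = {m0} ∧ m2 = {m1} ∧ m3 = {m2} ↔
      m0 = tag 0 ∧ m1 = tag 1 ∧ m2 = tag 2 ∧ m3 = tag 3 := by
    constructor
    · rintro ⟨rfl, rfl, rfl, rfl⟩
      exact ⟨rfl, rfl, rfl, rfl⟩
    · rintro ⟨rfl, rfl, rfl, rfl⟩
      exact ⟨rfl, rfl, rfl, rfl⟩
  rw [e1]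
  refine and_congr ?_ Iff.rfl
  have e2 : ∀ x ∈ Vclass γ, ((rEmp (Vclass γ) x ∨ ∃ y ∈ Vclass γ, y ∈ I ∧
      rUp (Vclass γ) x y y) ↔ (x = ∅ ∨ ∃ y ∈ I, x = {y})) := by
    intro x hx
    rw [rEmp_iff hx]
    simp only [rUp_iff hS hx, ZFSet.pair_eq_singleton]
    exact or_congr Iff.rfl ⟨fun ⟨y, _, h⟩ => ⟨y, h⟩, fun ⟨y, h⟩ => ⟨y, hS _ hI _ h.1, h⟩⟩
  constructor
  · intro h
    have h' : ∀ x ∈ Vclass γ, (x ∈ I ↔ x = ∅ ∨ ∃ y ∈ I, x = {y}) :=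
      fun x hx => (h x hx).trans (e2 x hx)
    have hpos : (∅ : ZFSet.{u}) ∈ Vclass γ := by
      have := hI
      simp only [Vclass, Set.mem_ofPred_eq] at this ⊢
      rw [ZFSet.rank_empty]
      exact (zero_le).trans_lt this
    ext x
    rw [mem_tags]
    constructor
    · induction x using ZFSet.inductionOn with
      | _ x ih =>
        intro hx
        rcases (h' x (hS _ hI _ hx)).1 hx with rfl | ⟨y, hy, rfl⟩
        · exact ⟨0, rfl⟩
        · obtain ⟨n, rfl⟩ := ih y (ZFSet.mem_singleton.2 rfl) hy
          exact ⟨n + 1, rfl⟩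
    · rintro ⟨n, rfl⟩
      induction n with
      | zero => exact (h' _ hpos).2 (Or.inl rfl)
      | succ n ih =>
        refine (h' _ ?_).2 (Or.inr ⟨_, ih, rfl⟩)
        have := hγ _ (hS _ hI _ ih)
        simpa [Vclass, tag] using this
  · rintro rfl x hx
    rw [e2 x hx, mem_tags]
    constructor
    · rintro ⟨n, rfl⟩
      cases n with
      | zero => exact Or.inl rfl
      | succ n => exact Or.inr ⟨tag n, mem_tags.2 ⟨n, rfl⟩, rfl⟩
    · rintro (rfl | ⟨y, hy, rfl⟩)
      · exact ⟨0, rfl⟩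
      · obtain ⟨n, rfl⟩ := mem_tags.1 hy
        exact ⟨n + 1, rfl⟩

theorem rLt_iff (hγ : ∀ o < γ, Order.succ o < γ) {a b : ZFSet.{u}} (ha : a ∈ Vclass γ)
    (hb : b ∈ Vclass γ) : rLt (Vclass γ) a b ↔ a.card < b.card := by
  have hS := Vclass_tr γ
  unfold rLt
  rw [← not_le, not_iff_not, ← surjZ_iff]
  constructor
  · rintro ⟨f, hf, h⟩
    rw [rSurj_iff hS hf hb] at h
    refine ⟨f ∩ ZFSet.prod a b, fun x hx => (ZFSet.mem_inter.1 hx).2, ?_, ?_⟩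
    · intro x y y' h1 h2
      exact h.1 x y y' (ZFSet.mem_inter.1 h1).1 (ZFSet.mem_inter.1 h2).1
    · intro y hy
      obtain ⟨x, hx, hxy⟩ := h.2 y hy
      exact ⟨x, hx, ZFSet.mem_inter.2 ⟨hxy, ZFSet.pair_mem_prod.2 ⟨hx, hy⟩⟩⟩
  · rintro ⟨f, hf, h⟩
    have hfS := Vclass_sub γ _ (V_prod hγ ha hb) _ hf
    exact ⟨f, hfS, (rSurj_iff hS hfS hb).2 h⟩

theorem rCard_iff (hγ : ∀ o < γ, Order.succ o < γ) {a : ZFSet.{u}} (ha : a ∈ Vclass γ) :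
    rCard (Vclass γ) a ↔ ZCard a := by
  have hS := Vclass_tr γ
  unfold rCard
  rw [zCard_iff, rOrd_iff hS ha, allMem ha]
  refine and_congr Iff.rfl (forall_congr' fun b => forall_congr' fun hb => ?_)
  exact rLt_iff hγ (hS _ ha _ hb) ha

theorem rHH_iff (hγ : ∀ o < γ, Order.succ o < γ) {M θ : ZFSet.{u}} (hM : M ∈ Vclass γ)
    (hθ : θ ∈ Vclass γ) (hθ' : ZCard θ) : rHH (Vclass γ) M θ ↔ ∀ x, x ∈ M ↔ x ∈ HSet θ := by
  have hS := Vclass_tr γ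
  have e : ∀ x ∈ Vclass γ, ((∃ t ∈ Vclass γ, rTrans (Vclass γ) t ∧ rSub (Vclass γ) x t ∧
      rLt (Vclass γ) t θ) ↔ x ∈ HSet θ) := by
    intro x hx
    rw [mem_HSet]
    constructor
    · rintro ⟨t, ht, h1, h2, h3⟩
      exact ⟨t, (rTrans_iff hS ht).1 h1, (rSub_iff hS hx).1 h2, (rLt_iff hγ ht hθ).1 h3⟩
    · rintro ⟨t, h1, h2, h3⟩
      have ht : t ∈ Vclass γ :=
        (rank_lt_of_mem_HSet hθ' (mem_HSet.2 ⟨t, h1, fun _ h => h, h3⟩)).trans hθ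
      exact ⟨t, ht, (rTrans_iff hS ht).2 h1, (rSub_iff hS hx).2 h2, (rLt_iff hγ ht hθ).2 h3⟩
  unfold rHH
  constructor
  · intro h x
    constructor
    · intro hx
      have hxS := hS _ hM _ hx
      exact (e x hxS).1 ((h x hxS).1 hx)
    · intro hx
      have hxS : x ∈ Vclass γ := (rank_lt_of_mem_HSet hθ' hx).trans hθ
      exact (h x hxS).2 ((e x hxS).2 hx)
  · intro h x hx
    rw [h, e x hx]

end


def fromSG : SG → SF
  | .mem i j => .mem i j
  | .eq i j => .eq i j
  | .nand φ ψ => .not (.and (fromSG φ) (fromSG ψ))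
  | .ex k φ => .ex k (fromSG φ)

theorem sat_fromSG (M : Set ZFSet.{u}) (φ : SG) :
    ∀ v, SatIn ∅ M (fromSG φ) v ↔ SatG M φ v := by
  induction φ with
  | mem i j => exact fun v => Iff.rfl
  | eq i j => exact fun v => Iff.rfl
  | nand φ ψ ih1 ih2 =>
    intro v
    exact not_congr (and_congr (ih1 v) (ih2 v))
  | ex k φ ih =>
    intro v
    exact exists_congr fun x => and_congr Iff.rfl (ih _)

def LimZ (x : ZFSet.{u}) : Prop := (∃ y, y ∈ x) ∧ ∀ y ∈ x, ∃ z ∈ x, y ∈ z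

structure Sem (A κ θ M C T F R : ZFSet.{u}) : Prop where
  cκ : ZCard κ
  cθ : ZCard θ
  lt : κ ∈ θ
  hM : ∀ x, x ∈ M ↔ x ∈ HSet θ
  lim : LimZ κ
  lim' : ∃ x ∈ κ, LimZ x
  fn : FunZ F
  fid : ∀ β ∈ κ, ZFSet.pair β β ∈ F
  f2 : ZFSet.pair (tag 2) κ ∈ F
  f3 : ∃ x, ZFSet.pair (tag 3) x ∈ F
  fdom : ∀ b x, ZFSet.pair b x ∈ F → b ∈ ZFSet.vonNeumann κ.rank ∧ x ∈ M
  fran : ∀ x, (x ∈ R ↔ ∃ b, ZFSet.pair b x ∈ F)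
  memC : ∀ i j : ℕ, cd 0 (tag i) (tag j) ∈ C ∧ ∀ v : ℕ → ZFSet.{u}, (∀ n, v n ∈ M) →
      (ZFSet.pair (cd 0 (tag i) (tag j)) (asg v) ∈ T ↔ v i ∈ v j)
  eqC : ∀ i j : ℕ, cd 1 (tag i) (tag j) ∈ C ∧ ∀ v : ℕ → ZFSet.{u}, (∀ n, v n ∈ M) →
      (ZFSet.pair (cd 1 (tag i) (tag j)) (asg v) ∈ T ↔ v i = v j)
  nandC : ∀ d ∈ C, ∀ d' ∈ C, cd 2 d d' ∈ C ∧ ∀ v : ℕ → ZFSet.{u}, (∀ n, v n ∈ M) →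
      (ZFSet.pair (cd 2 d d') (asg v) ∈ T ↔
        ¬ (ZFSet.pair d (asg v) ∈ T ∧ ZFSet.pair d' (asg v) ∈ T))
  exC : ∀ k : ℕ, ∀ d ∈ C, cd 3 (tag k) d ∈ C ∧ ∀ v : ℕ → ZFSet.{u}, (∀ n, v n ∈ M) →
      (ZFSet.pair (cd 3 (tag k) d) (asg v) ∈ T ↔
        ∃ x ∈ M, ZFSet.pair d (asg (Function.update v k x)) ∈ T)
  tv : ∀ k : ℕ, ∀ d ∈ C, ∀ v : ℕ → ZFSet.{u}, (∀ n, v n ∈ R) →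
      (∃ x ∈ M, ZFSet.pair d (asg (Function.update v k x)) ∈ T) →
      ∃ x ∈ R, ZFSet.pair d (asg (Function.update v k x)) ∈ T
  acl : ∀ c ∈ C, ∀ s, ZFSet.pair c s ∈ A →
      ∃ v : ℕ → ZFSet.{u}, (∀ n, v n ∈ M) ∧ ZFSet.pair c (asg v) ∈ T ∧
        ∀ n : ℕ, ∃ b, ZFSet.pair (tag n) b ∈ s ∧ ZFSet.pair b (v n) ∈ F

theorem Sem.to_rPhi {γ : Ordinal.{u}} (hγ : ∀ o < γ, Order.succ o < γ)
    {A κ θ M C T F R : ZFSet.{u}} (h : Sem A κ θ M C T F R) (hA : A ∈ Vclass γ)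
    (hθ : θ ∈ Vclass γ) (hM : M ∈ Vclass γ) (hC : C ∈ Vclass γ)
    (hT : T ∈ Vclass γ) (hF : F ∈ Vclass γ) (hR : R ∈ Vclass γ)
    (hV : ZFSet.vonNeumann κ.rank ∈ Vclass γ) (hI : tags ∈ Vclass γ) : rPhi (Vclass γ) A κ := by
  have hκ : κ ∈ Vclass γ := Vclass_tr γ _ hθ _ h.lt
  have hRM : R ⊆ M := fun x hx => by
    obtain ⟨b, hb⟩ := (h.fran x).1 hx
    exact (h.fdom _ _ hb).2
  refine ⟨θ, hθ, M, hM, tags, hI, C, hC, T, hT, F, hF, R, hR, _, hV, _, V_tag hI 0, _, V_tag hI 1,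
    _, V_tag hI 2, _, V_tag hI 3, ?_⟩
  refine ⟨?_, (rCard_iff hγ hκ).2 h.cκ, (rCard_iff hγ hθ).2 h.cθ, h.lt,
    (rHH_iff hγ hM hθ h.cθ).2 h.hM, ⟨(rLim_iff hκ).2 h.lim, ?_⟩,
    (rTags_iff hγ hI (V_tag hI 0) (V_tag hI 1) (V_tag hI 2) (V_tag hI 3)).2
      ⟨rfl, rfl, rfl, rfl, rfl⟩,
    (rFCl_iff hκ hF hR hV).2 ⟨h.fn, h.fid, h.f2, h.f3, h.fdom, rfl, h.fran⟩,
    (rMemC_iff hγ hM hI hC hT).2 h.memC, (rEqC_iff hγ hM hI hC hT).2 h.eqC,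
    (rNandC_iff hγ hM hI hC hT).2 h.nandC, (rExC_iff hγ hM hI hC hT).2 h.exC,
    (rTV_iff hγ hM hI hC hT hRM).2 h.tv, (rACl_iff hγ hM hI hC hT hA hF).2 h.acl⟩
  · intro x hx
    refine ⟨{x}, ?_, ZFSet.mem_singleton.2 rfl⟩
    show ZFSet.rank _ < γ
    rw [ZFSet.rank_singleton]
    exact hγ _ hx
  · obtain ⟨x, hx, hl⟩ := h.lim'
    have := Vclass_tr γ _ hκ _ hx
    exact ⟨x, this, hx, (rLim_iff this).2 hl⟩

theorem Sem.of_rPhi {γ : Ordinal.{u}} {A κ : ZFSet.{u}} (hA : A ∈ Vclass γ)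
    (h : rPhi (Vclass γ) A κ) : ∃ θ M C T F R, θ.rank < γ ∧ Sem A κ θ M C T F R := by
  obtain ⟨θ, hθ, M, hM, I, hI, C, hC, T, hT, F, hF, R, hR, V, hV, m0, h0, m1, h1, m2, h2, m3, h3,
    a1, a2, a3, a4, a5, ⟨a6, x, hx, hxκ, a7⟩, a8, a9, a10, a11, a12, a13, a14, a15⟩ := h
  have hγ : ∀ o < γ, Order.succ o < γ := by
    intro o ho
    obtain ⟨y, hy, hm⟩ := a1 (ZFSet.vonNeumann o) (by simpa [Vclass] using ho)
    have h1 := ZFSet.rank_lt_of_mem hm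
    rw [ZFSet.rank_vonNeumann] at h1
    exact (Order.succ_le_of_lt h1).trans_lt hy
  have hκ : κ ∈ Vclass γ := Vclass_tr γ _ hθ _ a4
  obtain ⟨rfl, rfl, rfl, rfl, rfl⟩ := (rTags_iff hγ hI h0 h1 h2 h3).1 a8
  obtain ⟨b1, b2, b3, b4, b5, rfl, b7⟩ := (rFCl_iff hκ hF hR hV).1 a9
  have hRM : R ⊆ M := fun x hx => by
    obtain ⟨b, hb⟩ := (b7 x).1 hx
    exact (b5 _ _ hb).2
  have c3 := (rCard_iff hγ hθ).1 a3
  exact ⟨θ, M, C, T, F, R, hθ,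
    { cκ := (rCard_iff hγ hκ).1 a2
      cθ := c3
      lt := a4
      hM := (rHH_iff hγ hM hθ c3).1 a5
      lim := (rLim_iff hκ).1 a6
      lim' := ⟨x, hxκ, (rLim_iff hx).1 a7⟩
      fn := b1
      fid := b2
      f2 := b3
      f3 := b4
      fdom := b5
      fran := b7
      memC := (rMemC_iff hγ hM hI hC hT).1 a10
      eqC := (rEqC_iff hγ hM hI hC hT).1 a11
      nandC := (rNandC_iff hγ hM hI hC hT).1 a12
      exC := (rExC_iff hγ hM hI hC hT).1 a13
      tv := (rTV_iff hγ hM hI hC hT hRM).1 a14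
      acl := (rACl_iff hγ hM hI hC hT hA hF).1 a15 }⟩

theorem upd_mem {R : Set ZFSet.{u}} {v : ℕ → ZFSet.{u}} (hv : ∀ n, v n ∈ R) {k : ℕ} {x : ZFSet.{u}}
    (hx : x ∈ R) (n : ℕ) : Function.update v k x n ∈ R := by
  by_cases h : n = k
  · subst h; simpa
  · rw [Function.update_of_ne h]; exact hv n

section
variable {A κ θ M C T F R : ZFSet.{u}}

theorem Sem.sat (h : Sem A κ θ M C T F R) (φ : SG) : code φ ∈ C ∧
    ∀ v : ℕ → ZFSet.{u}, (∀ n, v n ∈ M) →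
      (ZFSet.pair (code φ) (asg v) ∈ T ↔ SatG (HSet θ) φ v) := by
  induction φ with
  | mem i j => exact h.memC i j
  | eq i j => exact h.eqC i j
  | nand φ ψ ih1 ih2 =>
    obtain ⟨h1, h2⟩ := h.nandC _ ih1.1 _ ih2.1
    refine ⟨h1, fun v hv => (h2 v hv).trans ?_⟩
    rw [ih1.2 v hv, ih2.2 v hv]
    rfl
  | ex k φ ih =>
    obtain ⟨h1, h2⟩ := h.exC k _ ih.1
    refine ⟨h1, fun v hv => (h2 v hv).trans ?_⟩
    refine exists_congr fun x => ?_
    rw [h.hM]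
    refine and_congr_right fun hx => ih.2 _ ?_
    exact upd_mem (R := {x | x ∈ M}) hv ((h.hM x).2 hx)

theorem Sem.sub (h : Sem A κ θ M C T F R) : ∀ x ∈ R, x ∈ M := fun x hx => by
  obtain ⟨b, hb⟩ := (h.fran x).1 hx
  exact (h.fdom _ _ hb).2

theorem Sem.elem (h : Sem A κ θ M C T F R) (φ : SG) : ∀ v : ℕ → ZFSet.{u}, (∀ n, v n ∈ R) →
      (SatG {x | x ∈ R} φ v ↔ SatG (HSet θ) φ v) := by
  induction φ with
  | mem i j => exact fun _ _ => Iff.rfl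
  | eq i j => exact fun _ _ => Iff.rfl
  | nand φ ψ ih1 ih2 => exact fun v hv => not_congr (and_congr (ih1 v hv) (ih2 v hv))
  | ex k φ ih =>
    intro v hv
    constructor
    · rintro ⟨x, hx, hs⟩
      exact ⟨x, (h.hM x).1 (h.sub x hx), (ih _ (upd_mem (R := {x | x ∈ R}) hv hx)).1 hs⟩
    · rintro ⟨x, hx, hs⟩
      have hvM : ∀ n, v n ∈ M := fun n => h.sub _ (hv n)
      obtain ⟨y, hy, hs⟩ := h.tv k (code φ) (h.sat φ).1 v hv ⟨x, (h.hM x).2 hx,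
        ((h.sat φ).2 _ (upd_mem (R := {x | x ∈ M}) hvM ((h.hM x).2 hx))).2 hs⟩
      exact ⟨y, hy, (ih _ (upd_mem (R := {x | x ∈ R}) hv hy)).2
        (((h.sat φ).2 _ (upd_mem (R := {x | x ∈ M}) hvM (h.sub y hy))).1 hs)⟩

theorem LimZ.succ_lt {x : ZFSet.{u}} (h : LimZ x) :
    ∀ o < x.rank, Order.succ o < x.rank := by
  intro o ho
  rw [ZFSet.lt_rank_iff] at ho
  obtain ⟨y, hy, hoy⟩ := ho
  obtain ⟨z, hz, hyz⟩ := h.2 y hy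
  exact (Order.succ_le_succ hoy).trans_lt (lt_of_le_of_lt
    (Order.succ_le_of_lt (ZFSet.rank_lt_of_mem hyz)) (ZFSet.rank_lt_of_mem hz))

theorem LimZ.omega_le {x : ZFSet.{u}} (h : LimZ x) :
    Ordinal.omega0 ≤ x.rank := by
  obtain ⟨y, hy⟩ := h.1
  rw [Ordinal.omega0_le]
  intro n
  refine le_of_lt ?_
  induction n with
  | zero => exact (zero_le).trans_lt (ZFSet.rank_lt_of_mem hy)
  | succ n ih =>
    have := h.succ_lt _ ih
    simpa using this

theorem Sem.omega_lt (h : Sem A κ θ M C T F R) : Ordinal.omega0 < κ.rank := by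
  obtain ⟨x, hx, hl⟩ := h.lim'
  exact (hl.omega_le).trans_lt (ZFSet.rank_lt_of_mem hx)

theorem Sem.key (h : Sem A κ θ M C T F R) {N : Set ZFSet.{u}} {f : ZFSet.{u} → ZFSet.{u}}
    (hA : ∀ φ b, (ZFSet.pair (code φ) (asg b)).rank < κ.rank → SatG N φ (fun n => f (b n)) →
      ZFSet.pair (code φ) (asg b) ∈ A) (φ : SG) (b x : ℕ → ZFSet.{u})
    (hb : ∀ n, ZFSet.pair (b n) (x n) ∈ F) :
    SatG N φ (fun n => f (b n)) ↔ SatG (HSet θ) φ x := by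
  have one : ∀ (φ : SG) (b x : ℕ → ZFSet.{u}), (∀ n, ZFSet.pair (b n) (x n) ∈ F) →
      SatG N φ (fun n => f (b n)) → SatG (HSet θ) φ x := by
    intro φ b x hb hs
    obtain ⟨n, hn⟩ := satG_bdd.{u} φ
    let b' : ℕ → ZFSet.{u} := fun i => b (min i n)
    let x' : ℕ → ZFSet.{u} := fun i => x (min i n)
    have hs' : SatG N φ (fun n => f (b' n)) :=
      (hn N _ _ fun i hi => by simp [b', min_eq_left hi.le]).1 hs
    rw [hn _ x x' fun i hi => by simp [x', min_eq_left hi.le]]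
    have hb' : ∀ i, ZFSet.pair (b' i) (x' i) ∈ F := fun i => hb _
    have hl := h.lim.succ_lt
    have hrk : ∀ i, (b i).rank < κ.rank := fun i => by
      have := (h.fdom _ _ (hb i)).1
      rwa [ZFSet.mem_vonNeumann] at this
    have hbd : ∃ o < κ.rank, Ordinal.omega0 ≤ o ∧ ∀ i, (b' i).rank ≤ o := by
      have : ∀ m, ∃ o < κ.rank, Ordinal.omega0 ≤ o ∧ ∀ i ≤ m, (b i).rank ≤ o := by
        intro m
        induction m with
        | zero =>
          refine ⟨max Ordinal.omega0 (b 0).rank, max_lt h.omega_lt (hrk 0), le_max_left _ _, ?_⟩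
          intro i hi
          obtain rfl : i = 0 := by omega
          exact le_max_right _ _
        | succ m ih =>
          obtain ⟨o, h1, h2, h3⟩ := ih
          refine ⟨max o (b (m + 1)).rank, max_lt h1 (hrk _), h2.trans (le_max_left _ _), ?_⟩
          intro i hi
          rcases Nat.lt_or_ge i (m + 1) with hi' | hi'
          · exact (h3 i (by omega)).trans (le_max_left _ _)
          · obtain rfl : i = m + 1 := by omega
            exact le_max_right _ _
      obtain ⟨o, h1, h2, h3⟩ := this n
      exact ⟨o, h1, h2, fun i => h3 _ (min_le_right _ _)⟩
    obtain ⟨o, ho, hωo, hbo⟩ := hbd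
    have hr : (ZFSet.pair (code φ) (asg b')).rank < κ.rank :=
      rank_zpair_limit hl ((rank_code φ).trans h.omega_lt)
        ((rank_asg_le hωo hbo).trans_lt (hl _ (hl _ (hl _ ho))))
    obtain ⟨v, hv, hT, hbv⟩ := h.acl _ (h.sat φ).1 _ (hA φ b' hr hs')
    have hvx : v = x' := by
      funext i
      obtain ⟨c, hc, hcF⟩ := hbv i
      rw [pair_mem_asg] at hc
      subst hc
      exact h.fn _ _ _ hcF (hb' i)
    subst hvx
    exact ((h.sat φ).2 _ hv).1 hT
  refine ⟨one φ b x hb, fun hs => ?_⟩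
  by_contra hc
  have := one (.nand φ φ) b x hb (fun h => hc h.1)
  exact this ⟨hs, hs⟩
end


theorem tag_not_ord (n : ℕ) : ¬ (tag.{u} (n + 2)).IsOrdinal := by
  intro h
  have h1 : tag.{u} n ∈ tag.{u} (n + 1) := ZFSet.mem_singleton.2 rfl
  have h2 : tag.{u} (n + 1) ∈ tag.{u} (n + 2) := ZFSet.mem_singleton.2 rfl
  have h3 := h.isTransitive.mem_trans h1 h2
  have := tag_inj (ZFSet.mem_singleton.1 h3)
  omega

theorem mem_zpair {a b x : ZFSet.{u}} : x ∈ ZFSet.pair a b ↔ x = {a} ∨ x = {a, b} := by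
  simp [ZFSet.pair]

theorem pair_not_ord (a b : ZFSet.{u}) : ¬ (ZFSet.pair a b).IsOrdinal := by
  intro h
  have h1 : a ∈ ({a} : ZFSet.{u}) := ZFSet.mem_singleton.2 rfl
  have h3 := h.isTransitive.mem_trans h1 (mem_zpair.2 (Or.inl rfl))
  rcases mem_zpair.1 h3 with h | h
  · rw [← h] at h1
    exact ZFSet.mem_irrefl a h1
  · have h4 : a ∈ ({a, b} : ZFSet.{u}) := by simp
    rw [← h] at h4
    exact ZFSet.mem_irrefl a h4

theorem pair_ne_tag (b : ZFSet.{u}) (n : ℕ) (hn : n ≠ 4) : ZFSet.pair (tag 3) b ≠ tag (n + 1) := by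
  intro h
  have h1 : tag.{u} 4 ∈ ZFSet.pair (tag 3) b := mem_zpair.2 (Or.inl rfl)
  rw [h] at h1
  exact hn (tag_inj (ZFSet.mem_singleton.1 h1)).symm

theorem card_eq_rank {κ : ZFSet.{u}} (oκ : κ.IsOrdinal) : κ.card = κ.rank.card := by
  rw [← Ordinal.card_toZFSet, oκ.toZFSet_rank_eq]

theorem card_infinite {κ : ZFSet.{u}} (oκ : κ.IsOrdinal) (hω : Ordinal.omega0 ≤ κ.rank) :
    ℵ₀ ≤ κ.card := by
  rw [card_eq_rank oκ, ← Ordinal.card_omega0]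
  exact Ordinal.card_le_card hω

theorem rank_eq_ord {κ : ZFSet.{u}} (hκ : ZCard κ) : κ.rank = κ.card.ord := by
  obtain ⟨oκ, h⟩ := zCard_iff.1 hκ
  apply le_antisymm
  · by_contra hlt
    have h1 : κ.card.ord.toZFSet ∈ κ := by
      rw [← oκ.toZFSet_rank_eq, Ordinal.toZFSet_mem_toZFSet_iff, oκ.toZFSet_rank_eq]
      exact not_le.1 hlt
    have h2 := h _ h1
    rw [Ordinal.card_toZFSet, Cardinal.card_ord] at h2
    exact lt_irrefl _ h2
  · rw [Cardinal.ord_le, card_eq_rank oκ]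

theorem Shrewd.refl {κ : ZFSet.{u}} (h : Shrewd κ) {P : Set ZFSet.{u} → ZFSet.{u} → ZFSet.{u} → Prop}
    (hP : Df.{u} (fun S e => P S (e 0) (e 1))) (α : Ordinal.{u}) (A : ZFSet.{u})
    (hA : ∀ y ∈ A, y.rank < κ.rank) (hs : P (Vclass (κ.rank + α)) A κ) :
    ∃ κ' α' : ZFSet.{u}, κ' ∈ κ ∧ α' ∈ κ ∧ P (Vclass (κ'.rank + α'.rank)) (Vres A κ') κ' := by
  obtain ⟨φ, h1, h2⟩ := hP.formula2
  obtain ⟨κ', α', a, b, c⟩ := h.2 φ α.toZFSet A h1 (zOrd_iff.2 (ZFSet.isOrdinal_toZFSet α)) hA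
    ((h2 _ _ _).2 (by rwa [Ordinal.rank_toZFSet]))
  exact ⟨κ', α', a, b, (h2 _ _ _).1 c⟩

theorem Shrewd.lim {κ : ZFSet.{u}} (h : Shrewd κ) : LimZ κ := by
  have oκ := (zCard_iff.1 h.1).1
  constructor
  · obtain ⟨κ', _, h1, _⟩ := h.refl (P := fun _ _ _ => True) Df.true 0 ∅ (by simp) trivial
    exact ⟨κ', h1⟩
  · intro m hm
    have hr := ZFSet.rank_lt_of_mem hm
    obtain ⟨κ', α', h1, _, x, hx, hx'⟩ := h.refl (P := fun S a _ => ∃ x ∈ S, x ∈ a)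
      (Df.ex (Df.mem _ _)) 0 {m} (by simpa using hr) ⟨m, by simpa [Vclass] using hr, by simp⟩
    simp only [Vres, ZFSet.mem_sep, ZFSet.mem_singleton] at hx'
    obtain ⟨rfl, hx'⟩ := hx'
    exact ⟨κ', h1, (ZFSet.IsOrdinal.rank_lt_iff_mem (oκ.mem hm) (oκ.mem h1)).1 hx'⟩

theorem Shrewd.lim' {κ : ZFSet.{u}} (h : Shrewd κ) : ∃ x ∈ κ, LimZ x := by
  have key : ∀ (κ : ZFSet.{u}) (o : Ordinal.{u}), rLim (Vclass (κ.rank + o)) κ ↔ LimZ κ := by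
    intro κ o
    have hm : ∀ x ∈ κ, x ∈ Vclass (κ.rank + o) := fun x hx =>
      (ZFSet.rank_lt_of_mem hx).trans_le le_self_add
    unfold rLim LimZ
    constructor
    · rintro ⟨⟨y, _, hy⟩, h2⟩
      refine ⟨⟨y, hy⟩, fun y hy => ?_⟩
      obtain ⟨z, _, hz⟩ := h2 y (hm y hy) hy
      exact ⟨z, hz⟩
    · rintro ⟨⟨y, hy⟩, h2⟩
      refine ⟨⟨y, hm y hy, hy⟩, fun y _ hy => ?_⟩
      obtain ⟨z, hz⟩ := h2 y hy
      exact ⟨z, hm z hz.1, hz⟩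
  obtain ⟨κ', α', h1, _, h2⟩ := h.refl (P := fun S _ b => rLim S b) (Df.rLim 1) 0 ∅ (by simp)
    ((key _ _).2 h.lim)
  exact ⟨κ', h1, (key _ _).1 h2⟩

theorem exists_naming {κ z : ZFSet.{u}} (hκ : κ.IsOrdinal) (hl : LimZ κ)
    (hω : Ordinal.omega0 < κ.rank) {Y : Set ZFSet.{u}} (h1 : ∀ x ∈ κ, x ∈ Y) (h2 : κ ∈ Y)
    (hz : z ∈ Y) (hY : #Y = #κ.toSet) : ∃ f : ZFSet.{u} → ZFSet.{u},
      (∀ b, f b ∈ Y) ∧ (∀ β ∈ κ, f β = β) ∧ f (tag 2) = κ ∧ f (tag 3) = z ∧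
        ∀ y ∈ Y, ∃ b, b.rank < κ.rank ∧ f b = y := by
  classical
  obtain ⟨e⟩ := Cardinal.eq.1 hY
  have n2 : tag.{u} 2 ∉ κ := fun h => tag_not_ord 0 (hκ.mem h)
  have n3 : tag.{u} 3 ∉ κ := fun h => tag_not_ord 1 (hκ.mem h)
  have n23 : tag.{u} 3 ≠ tag 2 := fun h => by have := tag_inj h; omega
  let f : ZFSet.{u} → ZFSet.{u} := fun b =>
    if b ∈ κ then b else if b = tag 2 then κ else if b = tag 3 then z else
      if h : ∃ y : Y, b = ZFSet.pair (tag 3) (e y).1 then h.choose.1 else κ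
  have hf : ∀ y : Y, f (ZFSet.pair (tag 3) (e y).1) = y.1 := by
    intro y
    have a1 : ZFSet.pair (tag 3) (e y).1 ∉ κ := fun h => pair_not_ord _ _ (hκ.mem h)
    have a4 : ∃ y' : Y, ZFSet.pair (tag 3) (e y).1 = ZFSet.pair (tag 3) (e y').1 := ⟨y, rfl⟩
    simp only [f]
    rw [if_neg a1, if_neg (pair_ne_tag _ 1 (by omega)), if_neg (pair_ne_tag _ 2 (by omega)),
      dif_pos a4]
    have := (ZFSet.pair_injective a4.choose_spec).2
    have := e.injective (Subtype.ext this)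
    rw [← this]
  refine ⟨f, ?_, ?_, ?_, ?_, ?_⟩
  · intro b
    simp only [f]
    split_ifs with g1 g2 g3 g4
    · exact h1 _ g1
    · exact h2
    · exact hz
    · exact g4.choose.2
    · exact h2
  · intro β hβ
    simp [f, hβ]
  · simp [f, n2]
  · simp [f, n3, n23]
  · intro y hy
    refine ⟨_, ?_, hf ⟨y, hy⟩⟩
    exact rank_zpair_limit hl.succ_lt ((rank_tag 3).trans hω) (ZFSet.rank_lt_of_mem (e ⟨y, hy⟩).2)

theorem true_world {κ θ z : ZFSet.{u}} (hκ : ZCard κ) (hl : LimZ κ) (hl' : ∃ x ∈ κ, LimZ x)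
    (hθ : ZCard θ) (hκθ : κ ∈ θ) (hz : z ∈ HSet θ) {γ : Ordinal.{u}}
    (hγ : ∀ o < γ, Order.succ o < γ) (hθγ : θ.rank < γ) :
    ∃ (f : ZFSet.{u} → ZFSet.{u}) (A : ZFSet.{u}), (∀ b, f b ∈ HSet θ) ∧ (∀ β ∈ κ, f β = β) ∧
      f (tag 2) = κ ∧ f (tag 3) = z ∧ (∀ y ∈ A, y.rank < κ.rank) ∧
      (∀ φ b, (ZFSet.pair (code φ) (asg b)).rank < κ.rank →
        SatG (HSet θ) φ (fun n => f (b n)) → ZFSet.pair (code φ) (asg b) ∈ A) ∧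
      rPhi (Vclass γ) A κ := by
  have oκ : κ.IsOrdinal := (zCard_iff.1 hκ).1
  have oθ : θ.IsOrdinal := (zCard_iff.1 hθ).1
  have hω : Ordinal.omega0 < κ.rank := by
    obtain ⟨x, hx, h⟩ := hl'
    exact h.omega_le.trans_lt (ZFSet.rank_lt_of_mem hx)
  have hκγ : κ.rank < γ := (ZFSet.rank_lt_of_mem hκθ).trans hθγ
  have hκH : κ ∈ HSet θ := mem_HSet.2 ⟨κ, oκ.isTransitive, fun _ h => h, (zCard_iff.1 hθ).2 κ hκθ⟩
  have hκsub : κ.toSet ⊆ HSet θ := fun x hx => HSet_tr θ _ hκH _ hx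
  have hinf : ℵ₀ ≤ #κ.toSet := by
    rw [mk_toSet, Cardinal.aleph0_le_lift]
    exact card_infinite oκ hω.le
  obtain ⟨Y, hsY, hYc, hYE⟩ := lowenheim (HSet θ) (insert κ (insert z κ.toSet))
    (by
      rintro x (rfl | rfl | hx)
      · exact hκH
      · exact hz
      · exact hκsub hx)
    (#κ.toSet) hinf (by
      refine (Cardinal.mk_insert_le).trans ?_
      refine (add_le_add_left (Cardinal.mk_insert_le) _).trans ?_
      have h1 : (1 : Cardinal.{u+1}) ≤ ℵ₀ := Cardinal.one_le_aleph0
      rw [Cardinal.add_one_eq hinf, Cardinal.add_one_eq hinf])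
    (Cardinal.mk_le_mk_of_subset hκsub)
  obtain ⟨f, fY, fid, f2, f3, fs⟩ := exists_naming oκ hl hω
    (fun x hx => hsY (Or.inr (Or.inr hx))) (hsY (Or.inl rfl)) (hsY (Or.inr (Or.inl rfl))) hYc
  have fH : ∀ b, f b ∈ HSet θ := fun b => hYE.1 (fY b)
  have hYG : ∀ (φ : SG) (v : ℕ → ZFSet.{u}), (∀ n, v n ∈ Y) → (SatG Y φ v ↔ SatG (HSet θ) φ v) := by
    intro φ v hv
    rw [← sat_fromSG, ← sat_fromSG]
    exact hYE.2 _ v hv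
  let VV : ZFSet.{u} := ZFSet.vonNeumann κ.rank
  let M : ZFSet.{u} := ZFSet.sep (· ∈ HSet θ) (ZFSet.vonNeumann θ.rank)
  let C : ZFSet.{u} := ZFSet.sep (fun c => ∃ φ, c = code φ) (ZFSet.vonNeumann Ordinal.omega0)
  let T : ZFSet.{u} := ZFSet.sep (fun p => ∃ φ v, p = ZFSet.pair (code φ) (asg v) ∧
    SatG (HSet θ) φ v) (ZFSet.prod C (ZFSet.powerset (ZFSet.prod tags M)))
  let F : ZFSet.{u} := ZFSet.sep (fun p => ∃ b, p = ZFSet.pair b (f b)) (ZFSet.prod VV M)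
  let R : ZFSet.{u} := ZFSet.sep (· ∈ Y) M
  let A : ZFSet.{u} := ZFSet.sep (fun p => ∃ φ b, p = ZFSet.pair (code φ) (asg b) ∧
    SatG (HSet θ) φ (fun n => f (b n))) VV
  have hM : ∀ x, x ∈ M ↔ x ∈ HSet θ := by
    intro x
    simp only [M, ZFSet.mem_sep, ZFSet.mem_vonNeumann]
    exact ⟨fun h => h.2, fun h => ⟨rank_lt_of_mem_HSet hθ h, h⟩⟩
  have hC : ∀ x, x ∈ C ↔ ∃ φ, x = code φ := by
    intro x
    simp only [C, ZFSet.mem_sep, ZFSet.mem_vonNeumann]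
    exact ⟨fun h => h.2, fun ⟨φ, h⟩ => ⟨h ▸ rank_code φ, φ, h⟩⟩
  have hT : ∀ φ (v : ℕ → ZFSet.{u}), (∀ n, v n ∈ M) →
      (ZFSet.pair (code φ) (asg v) ∈ T ↔ SatG (HSet θ) φ v) := by
    intro φ v hv
    simp only [T, ZFSet.mem_sep]
    constructor
    · rintro ⟨-, ψ, w, h, hs⟩
      obtain ⟨e1, e2⟩ := ZFSet.pair_injective h
      rw [code_inj e1, asg_inj e2]
      exact hs
    · intro hs
      refine ⟨?_, φ, v, rfl, hs⟩
      rw [ZFSet.pair_mem_prod, ZFSet.mem_powerset]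
      refine ⟨(hC _).2 ⟨φ, rfl⟩, fun p hp => ?_⟩
      obtain ⟨n, rfl⟩ := mem_asg.1 hp
      rw [ZFSet.pair_mem_prod]
      exact ⟨mem_tags.2 ⟨n, rfl⟩, hv n⟩
  have hF : ∀ b x, ZFSet.pair b x ∈ F ↔ b.rank < κ.rank ∧ x = f b := by
    intro b x
    simp only [F, ZFSet.mem_sep, ZFSet.pair_mem_prod, VV, ZFSet.mem_vonNeumann]
    constructor
    · rintro ⟨⟨h1, -⟩, c, h⟩
      obtain ⟨e1, e2⟩ := ZFSet.pair_injective h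
      subst e1
      exact ⟨h1, e2⟩
    · rintro ⟨h1, rfl⟩
      exact ⟨⟨h1, (hM _).2 (fH b)⟩, b, rfl⟩
  have hR : ∀ x, x ∈ R ↔ x ∈ Y := by
    intro x
    simp only [R, ZFSet.mem_sep, hM]
    exact ⟨fun h => h.2, fun h => ⟨hYE.1 h, h⟩⟩
  have hA : ∀ p, p ∈ A ↔ p.rank < κ.rank ∧ ∃ φ b, p = ZFSet.pair (code φ) (asg b) ∧
      SatG (HSet θ) φ (fun n => f (b n)) := by
    intro p
    simp only [A, ZFSet.mem_sep, VV, ZFSet.mem_vonNeumann]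
  have hsem : Sem A κ θ M C T F R :=
    { cκ := hκ
      cθ := hθ
      lt := hκθ
      hM := hM
      lim := hl
      lim' := hl'
      fn := fun x y y' h h' => by rw [((hF _ _).1 h).2, ((hF _ _).1 h').2]
      fid := fun β hβ => (hF _ _).2 ⟨ZFSet.rank_lt_of_mem hβ, (fid β hβ).symm⟩
      f2 := (hF _ _).2 ⟨(rank_tag 2).trans hω, f2.symm⟩
      f3 := ⟨z, (hF _ _).2 ⟨(rank_tag 3).trans hω, f3.symm⟩⟩
      fdom := fun b x h => by
        obtain ⟨h1, rfl⟩ := (hF _ _).1 h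
        exact ⟨ZFSet.mem_vonNeumann.2 h1, (hM _).2 (fH b)⟩
      fran := fun x => by
        rw [hR]
        constructor
        · intro hx
          obtain ⟨b, hb, rfl⟩ := fs x hx
          exact ⟨b, (hF _ _).2 ⟨hb, rfl⟩⟩
        · rintro ⟨b, hb⟩
          rw [((hF _ _).1 hb).2]
          exact fY b
      memC := fun i j => ⟨(hC _).2 ⟨.mem i j, rfl⟩, fun v hv => hT (.mem i j) v hv⟩
      eqC := fun i j => ⟨(hC _).2 ⟨.eq i j, rfl⟩, fun v hv => hT (.eq i j) v hv⟩
      nandC := fun d hd d' hd' => by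
        obtain ⟨φ, rfl⟩ := (hC _).1 hd
        obtain ⟨ψ, rfl⟩ := (hC _).1 hd'
        refine ⟨(hC _).2 ⟨.nand φ ψ, rfl⟩, fun v hv => (hT (.nand φ ψ) v hv).trans ?_⟩
        rw [hT φ v hv, hT ψ v hv]
        rfl
      exC := fun k d hd => by
        obtain ⟨φ, rfl⟩ := (hC _).1 hd
        refine ⟨(hC _).2 ⟨.ex k φ, rfl⟩, fun v hv => (hT (.ex k φ) v hv).trans ?_⟩
        refine exists_congr fun x => ?_
        rw [hM]
        refine and_congr_right fun hx => ?_
        rw [hT _ _ (upd_mem (R := {x | x ∈ M}) hv ((hM x).2 hx))]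
      tv := fun k d hd v hv => by
        obtain ⟨φ, rfl⟩ := (hC _).1 hd
        have hvM : ∀ n, v n ∈ M := fun n => (hM _).2 (hYE.1 ((hR _).1 (hv n)))
        have hvY : ∀ n, v n ∈ Y := fun n => (hR _).1 (hv n)
        rintro ⟨x, hx, h⟩
        rw [hT _ _ (upd_mem (R := {x | x ∈ M}) hvM hx)] at h
        obtain ⟨y, hy, h'⟩ := (hYG (.ex k φ) v hvY).2 ⟨x, (hM x).1 hx, h⟩
        refine ⟨y, (hR _).2 hy, ?_⟩
        rw [hT _ _ (upd_mem (R := {x | x ∈ M}) hvM ((hM _).2 (hYE.1 hy)))]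
        exact (hYG φ _ (upd_mem hvY hy)).1 h'
      acl := fun c hc s hs => by
        obtain ⟨hr, φ, b, he, h⟩ := (hA _).1 hs
        obtain ⟨rfl, rfl⟩ := ZFSet.pair_injective he
        have hv : ∀ n, f (b n) ∈ M := fun n => (hM _).2 (fH _)
        refine ⟨fun n => f (b n), hv, (hT φ _ hv).2 h, fun n => ⟨b n, pair_mem_asg.2 rfl, ?_⟩⟩
        refine (hF _ _).2 ⟨?_, rfl⟩
        have r1 : (asg b).rank < κ.rank := by
          rw [rank_zpair] at hr
          exact (le_max_right _ _).trans_lt (((Order.le_succ _).trans (Order.le_succ _)).trans_lt hr)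
        have r2 := (ZFSet.rank_lt_of_mem (pair_mem_asg.2 rfl : ZFSet.pair (tag n) (b n) ∈ asg b)).trans r1
        rw [rank_zpair] at r2
        exact (le_max_right _ _).trans_lt (((Order.le_succ _).trans (Order.le_succ _)).trans_lt r2) }
  have sb := Vclass_sub γ
  have vN : ∀ o < γ, ZFSet.vonNeumann o ∈ Vclass γ := fun o ho => by simpa [Vclass] using ho
  have vV : VV ∈ Vclass γ := vN _ hκγ
  have vM : M ∈ Vclass γ := sb _ (vN _ hθγ) _ (ZFSet.sep_subset)
  have vC : C ∈ Vclass γ := sb _ (vN _ (hω.trans hκγ)) _ (ZFSet.sep_subset)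
  have vI : tags ∈ Vclass γ := rank_tags.trans_lt (hω.trans hκγ)
  have vT : T ∈ Vclass γ := by
    refine sb _ (V_prod hγ vC ?_) _ (ZFSet.sep_subset)
    show ZFSet.rank _ < γ
    rw [ZFSet.rank_powerset]
    exact hγ _ (V_prod hγ vI vM)
  refine ⟨f, A, fH, fid, f2, f3, fun y hy => ((hA y).1 hy).1,
    fun φ b h1 h2 => (hA _).2 ⟨h1, φ, b, rfl, h2⟩,
    hsem.to_rPhi hγ (sb _ vV _ (ZFSet.sep_subset)) hθγ vM vC vT
      (sb _ (V_prod hγ vV vM) _ (ZFSet.sep_subset)) (sb _ vM _ (ZFSet.sep_subset)) vV vI⟩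

theorem Shrewd.embProp {κ : ZFSet.{u}} (h : Shrewd κ) : EmbProp κ := by
  intro θ hθ hκθ z hz
  have hκ := h.1
  have oκ : κ.IsOrdinal := (zCard_iff.1 hκ).1
  have hω : Ordinal.omega0 < κ.rank := by
    obtain ⟨x, hx, h⟩ := h.lim'
    exact h.omega_le.trans_lt (ZFSet.rank_lt_of_mem hx)
  have hγ : ∀ o < κ.rank + (θ.rank + Ordinal.omega0),
      Order.succ o < κ.rank + (θ.rank + Ordinal.omega0) := by
    rw [← add_assoc]
    exact fun o ho => (Ordinal.isSuccLimit_add _ Ordinal.isSuccLimit_omega0).succ_lt ho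
  have hθγ : θ.rank < κ.rank + (θ.rank + Ordinal.omega0) := by
    refine lt_of_lt_of_le ?_ le_add_self
    exact lt_add_of_pos_right _ Ordinal.omega0_pos
  obtain ⟨f, A, fH, fid, f2, f3, hA, hA', hphi⟩ := true_world hκ h.lim h.lim' hθ hκθ hz hγ hθγ
  obtain ⟨κ', α', hκ', hα', hphi'⟩ := h.refl (P := rPhi) (Df.rPhi 0 1) _ A hA hphi
  have hprin : κ'.rank + α'.rank < κ.rank := by
    have h1 := ZFSet.rank_lt_of_mem hκ'
    have h2 := ZFSet.rank_lt_of_mem hα'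
    rw [rank_eq_ord hκ] at h1 h2 ⊢
    exact Ordinal.isPrincipal_add_ord (card_infinite oκ hω.le) h1 h2
  have hAV : Vres A κ' ∈ Vclass (κ'.rank + α'.rank) := by
    obtain ⟨θ', hθ', _, _, _, _, _, _, _, _, _, _, _, _, _, _, _, _, _, _, _, _, _, _,
      _, _, _, a4, _⟩ := hphi'
    have : κ'.rank < κ'.rank + α'.rank := (ZFSet.rank_lt_of_mem a4).trans hθ'
    refine lt_of_le_of_lt ?_ this
    rw [ZFSet.rank_le_iff]
    intro y hy
    simp only [Vres, ZFSet.mem_sep] at hy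
    exact hy.2
  obtain ⟨θ', M, C, T, F, R, hθ'r, S⟩ := Sem.of_rPhi hAV hphi'
  have oθ' : θ'.IsOrdinal := (zCard_iff.1 S.cθ).1
  have key := S.key (N := HSet θ) (f := f) (fun φ b h1 h2 => by
    simp only [Vres, ZFSet.mem_sep]
    exact ⟨hA' φ b (h1.trans (ZFSet.rank_lt_of_mem hκ')) h2, h1⟩)
  choose! nm hnm using fun x hx => (S.fran x).1 hx
  have wd : ∀ b x, ZFSet.pair b x ∈ F → f (nm x) = f b := by
    intro b x hb
    have hx : x ∈ R := (S.fran x).2 ⟨b, hb⟩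
    have := key (.eq 0 1) (fun n => if n = 0 then nm x else b) (fun _ => x) (fun n => by
      by_cases hn : n = 0
      · simpa [hn] using hnm x hx
      · simpa [hn] using hb)
    simpa [SatG] using this
  have emb : ∀ (φ : SG) (v : ℕ → ZFSet.{u}), (∀ n, v n ∈ R) →
      (SatG (HSet θ) φ (fun n => f (nm (v n))) ↔ SatG (HSet θ') φ v) := fun φ v hv =>
    key φ (fun n => nm (v n)) v (fun n => hnm _ (hv n))
  obtain ⟨x3, hx3⟩ := S.f3
  refine ⟨κ', θ', {x | x ∈ R}, fun x => f (nm x), S.cκ, S.cθ, S.lt, ?_, ⟨?_, ?_⟩, ⟨?_, ?_⟩,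
    ?_, ?_, ?_, ?_, x3, ?_, ?_⟩
  · exact (ZFSet.IsOrdinal.rank_lt_iff_mem oθ' oκ).1 (hθ'r.trans hprin)
  · exact fun x hx => (S.hM x).1 (S.sub x hx)
  · intro φ v hv
    rw [← satG_toSG, ← satG_toSG]
    exact S.elem _ v hv
  · exact fun x _ => fH _
  · intro φ v hv
    rw [← satG_toSG, ← satG_toSG, S.elem _ v hv]
    exact (emb _ v hv).symm
  · exact fun β hβ => (S.fran β).2 ⟨β, S.fid β hβ⟩
  · exact (S.fran κ').2 ⟨_, S.f2⟩
  · intro β hβ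
    show f (nm β) = β
    rw [wd β β (S.fid β hβ)]
    exact fid β (oκ.isTransitive.mem_trans hβ hκ')
  · show f (nm κ') = κ
    rw [wd _ _ S.f2, f2]
  · exact (S.fran _).2 ⟨_, hx3⟩
  · show f (nm x3) = z
    rw [wd _ _ hx3, f3]

/-- A cardinal `κ` is shrewd if and only if for all cardinals `θ > κ` and all
`z ∈ H(θ)`, there are cardinals `κ̄ < θ̄ < κ`, an elementary submodel `X` of
`H(θ̄)` and an elementary embedding `j : X → H(θ)` with `κ̄ + 1 ⊆ X`,
`j ↾ κ̄ = id`, `j(κ̄) = κ` and `z ∈ ran(j)`. -/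
theorem shrewd_iff_embedding (κ : ZFSet.{u}) (hκ : ZCard κ) :
    Shrewd κ ↔
      ∀ θ : ZFSet.{u}, ZCard θ → κ ∈ θ → ∀ z ∈ HSet θ,
        ∃ (κ' θ' : ZFSet.{u}) (X : Set ZFSet.{u}) (j : ZFSet.{u} → ZFSet.{u}),
          ZCard κ' ∧ ZCard θ' ∧ κ' ∈ θ' ∧ θ' ∈ κ ∧
          ElemSub ∅ X (HSet θ') ∧ ElemEmbOn ∅ X (HSet θ) j ∧
          (∀ β ∈ κ', β ∈ X) ∧ κ' ∈ X ∧
          (∀ β ∈ κ', j β = β) ∧ j κ' = κ ∧ ∃ x ∈ X, j x = z := by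
  exact ⟨fun h => h.embProp, fun H => EmbProp.shrewd hκ H⟩
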